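/- Let f ∈ K(z) be a rational function of degree d > 1, extended canonically to a continuous self-map of P^1_Berk(K). Let μ be a Radon probability measure on P^1_Berk(K) such that f^{-1}(supp μ) = supp μ and μ({S}) = 0 for every S ∈ P^1_Berk(K) \ P^1(K). If U is a connected component of P^1_Berk(K) \ supp μ with f^{-1}(U) ≠ U, then ∂U ≠ supp μ. -/

import Mathlib

open scoped Classical

open Polynomial Filter MeasureTheory Topology

variable (K : Type*) [NontriviallyNormedField K] [IsAlgClosed K] [CompleteSpace K]
  [IsUltrametricDist K]

/-- The degree of a rational function: max of degrees of numerator and denominator. -/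
noncomputable def rdeg (h : RatFunc K) : ℕ := max h.num.natDegree h.denom.natDegree

/-- Canonical homogeneous coordinates of a point of `P^1(K) = K ∪ {∞}`. -/
noncomputable def homCoord : OnePoint K → K × K :=
  OnePoint.rec (1, 0) (fun a => (a, 1))

/-- The (normalized) chordal metric on `P^1(K)`:
`[z,w] = |z0*w1 - z1*w0| / (max(|z0|,|z1|) * max(|w0|,|w1|))`. -/
noncomputable def chordal (x y : OnePoint K) : ℝ :=
  ‖(homCoord K x).1 * (homCoord K y).2 - (homCoord K x).2 * (homCoord K y).1‖ /
    (max ‖(homCoord K x).1‖ ‖(homCoord K x).2‖ * max ‖(homCoord K y).1‖ ‖(homCoord K y).2‖)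

/-- The action of a rational function on the projective line `P^1(K) = K ∪ {∞}`. -/
noncomputable def evalP1 (h : RatFunc K) : OnePoint K → OnePoint K :=
  OnePoint.rec
    (if h.denom.natDegree < h.num.natDegree then OnePoint.infty
      else ((h.num.coeff h.denom.natDegree / h.denom.leadingCoeff : K) : OnePoint K))
    (fun a => if h.denom.eval a = 0 then OnePoint.infty
      else ((h.num.eval a / h.denom.eval a : K) : OnePoint K))

/-- Composition of rational functions. -/
noncomputable def rcomp (f g : RatFunc K) : RatFunc K :=
  RatFunc.eval (algebraMap K (RatFunc K)) g f

/-- Iterates of a rational function, as rational functions. -/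
noncomputable def riter (f : RatFunc K) : ℕ → RatFunc K
  | 0 => RatFunc.X
  | n + 1 => rcomp K f (riter f n)

/-- The Berkovich affine line `A^1(K)`: multiplicative seminorms on `K[z]`
whose restriction to `K` is the absolute value of `K`. -/
structure BerkA1 where
  /-- the seminorm, as a function on polynomials -/
  toFun : Polynomial K → ℝ
  nonneg' : ∀ p, 0 ≤ toFun p
  map_mul' : ∀ p q, toFun (p * q) = toFun p * toFun q
  add_le' : ∀ p q, toFun (p + q) ≤ toFun p + toFun q
  restricts' : ∀ c : K, toFun (Polynomial.C c) = ‖c‖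

/-- The topology of pointwise convergence on the Berkovich affine line. -/
instance : TopologicalSpace (BerkA1 K) :=
  TopologicalSpace.induced BerkA1.toFun Pi.topologicalSpace

/-- The Berkovich projective line `P^1_Berk(K)`, the one-point compactification of the
Berkovich affine line. -/
abbrev BerkP1 := OnePoint (BerkA1 K)

/-- The evaluation seminorm `p ↦ ‖p(a)‖` attached to a classical point `a ∈ K`. -/
noncomputable def evalSeminorm (a : K) : BerkA1 K where
  toFun p := ‖p.eval a‖
  nonneg' p := norm_nonneg _
  map_mul' p q := by simp [norm_mul]
  add_le' p q := by simpa using norm_add_le (p.eval a) (q.eval a)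
  restricts' c := by simp

/-- The canonical embedding of the classical projective line `P^1(K) = K ∪ {∞}`
into the Berkovich projective line. -/
noncomputable def iota : OnePoint K → BerkP1 K :=
  OnePoint.map (evalSeminorm K)

noncomputable instance : MeasurableSpace (BerkP1 K) := borel _

instance : BorelSpace (BerkP1 K) := ⟨rfl⟩

/-- The support of a measure: points all of whose open neighborhoods have positive measure. -/
def msupport (μ : Measure (BerkP1 K)) : Set (BerkP1 K) :=
  {x | ∀ U : Set (BerkP1 K), IsOpen U → x ∈ U → 0 < μ U}

/-- Weak convergence of a sequence of measures on the Berkovich projective line: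
integrals of every continuous real-valued function converge. -/
def WeakTendsto (μs : ℕ → Measure (BerkP1 K)) (μ : Measure (BerkP1 K)) : Prop :=
  ∀ φ : C(BerkP1 K, ℝ),
    Tendsto (fun n => ∫ x, φ x ∂(μs n)) atTop (𝓝 (∫ x, φ x ∂μ))


set_option linter.unusedSectionVars false



/-- A bounded ultrametric with densely many distances from each point. -/
structure UM {M : Type*} (d : M → M → ℝ) : Prop where
  self : ∀ a, d a a = 0
  eq : ∀ a b, d a b = 0 → a = b
  symm : ∀ a b, d a b = d b a
  nonneg : ∀ a b, 0 ≤ d a b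
  le1 : ∀ a b, d a b ≤ 1
  ult : ∀ a b c, d a c ≤ max (d a b) (d b c)
  dense : ∀ a α β, 0 ≤ α → α < β → β ≤ 1 → ∃ c, α < d a c ∧ d a c < β

/-- The space of ultrametric functions, a model of the Berkovich line. -/
def XS {M : Type*} (d : M → M → ℝ) : Type _ :=
  {φ : M → ℝ // (∀ a, 0 ≤ φ a ∧ φ a ≤ 1) ∧ (∀ a b, φ a ≤ max (φ b) (d a b)) ∧
    ∀ a b, d a b ≤ max (φ a) (φ b)}

namespace XS

variable {M : Type*} {d : M → M → ℝ}

instance : TopologicalSpace (XS d) := instTopologicalSpaceSubtype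

instance : T2Space (XS d) := inferInstanceAs (T2Space (Subtype _))

instance : CoeFun (XS d) (fun _ => M → ℝ) := ⟨fun x => x.1⟩

/-- underlying function -/
def val (x : XS d) : M → ℝ := x.1

theorem val_inducing : Topology.IsInducing (val : XS d → M → ℝ) := ⟨rfl⟩

theorem ext' {x y : XS d} (h : ∀ a, x a = y a) : x = y := Subtype.ext (funext h)

theorem nonneg (x : XS d) (a : M) : 0 ≤ x a := (x.2.1 a).1
theorem le1 (x : XS d) (a : M) : x a ≤ 1 := (x.2.1 a).2
theorem u1 (x : XS d) (a b : M) : x a ≤ max (x b) (d a b) := x.2.2.1 a b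
theorem u2 (x : XS d) (a b : M) : d a b ≤ max (x a) (x b) := x.2.2.2 a b

theorem cont (a : M) : Continuous (fun x : XS d => x a) :=
  (continuous_apply a).comp continuous_subtype_val

instance : CompactSpace (XS d) := by
  rw [← isCompact_univ_iff, val_inducing.isCompact_iff]
  have hr : (val '' (Set.univ : Set (XS d))) = {φ : M → ℝ | (∀ a, 0 ≤ φ a ∧ φ a ≤ 1) ∧
    (∀ a b, φ a ≤ max (φ b) (d a b)) ∧ ∀ a b, d a b ≤ max (φ a) (φ b)} := by
    ext φ
    constructor
    · rintro ⟨x, -, rfl⟩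
      exact x.2
    · intro h
      exact ⟨⟨φ, h⟩, trivial, rfl⟩
  rw [hr]
  apply IsCompact.of_isClosed_subset (isCompact_univ_pi (fun _ : M => isCompact_Icc (a := (0:ℝ)) (b := 1)))
  · simp only [Set.ofPred_and, Set.ofPred_forall]
    refine IsClosed.inter ?_ (IsClosed.inter ?_ ?_)
    · refine isClosed_iInter fun a => IsClosed.inter ?_ ?_
      · exact isClosed_le continuous_const (continuous_apply a)
      · exact isClosed_le (continuous_apply a) continuous_const
    · refine isClosed_iInter fun a => isClosed_iInter fun b => ?_
      exact isClosed_le (continuous_apply a) ((continuous_apply b).max continuous_const)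
    · refine isClosed_iInter fun a => isClosed_iInter fun b => ?_
      exact isClosed_le continuous_const ((continuous_apply a).max (continuous_apply b))
  · intro φ h a _
    exact h.1 a

/-- The classical points. -/
def io (hd : UM d) (a : M) : XS d :=
  ⟨fun b => d a b, fun b => ⟨hd.nonneg _ _, hd.le1 _ _⟩,
    fun b c => (hd.ult a c b).trans_eq (by rw [hd.symm c b]),
    fun b c => (hd.ult b a c).trans_eq (by rw [hd.symm b a])⟩

@[simp] theorem io_apply (hd : UM d) (a b : M) : io hd a b = d a b := rfl

theorem eq_io (hd : UM d) {x : XS d} {a : M} (h : x a = 0) : x = io hd a := by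
  apply ext'
  intro b
  rw [io_apply]
  apply le_antisymm
  · have := x.u1 b a
    rw [h, max_eq_right (hd.nonneg _ _), hd.symm] at this
    exact this
  · have := x.u2 a b
    rwa [h, max_eq_right (x.nonneg _)] at this

/-- The upward flow. -/
noncomputable def up (x : XS d) (t : ℝ) : XS d :=
  ⟨fun a => max (x a) (min 1 t), fun a => ⟨le_max_of_le_left (x.nonneg a),
      max_le (x.le1 a) (min_le_left _ _)⟩,
    fun a b => by
      have := x.u1 a b
      grind,
    fun a b => by
      have := x.u2 a b
      grind⟩

theorem up_apply (x : XS d) {t : ℝ} (ht : t ≤ 1) (a : M) : x.up t a = max (x a) t := by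
  change max (x a) (min 1 t) = _
  rw [min_eq_right ht]

theorem up_cont (x : XS d) : Continuous (fun t : ℝ => x.up t) := by
  apply Continuous.subtype_mk
  fun_prop

theorem up_zero (x : XS d) : x.up 0 = x := by
  apply ext'
  intro a
  rw [up_apply _ zero_le_one, max_eq_left (x.nonneg a)]

theorem up_one (x y : XS d) : x.up 1 = y.up 1 := by
  apply ext'
  intro a
  rw [up_apply _ le_rfl, up_apply _ le_rfl, max_eq_right (x.le1 _), max_eq_right (y.le1 _)]

theorem up_eq (x y : XS d) {a : M} {t : ℝ} (ht : t ≤ 1) (hx : x a ≤ t) (hy : y a ≤ t) :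
    x.up t = y.up t := by
  apply ext'
  intro b
  rw [up_apply _ ht, up_apply _ ht]
  have h1 := x.u1 b a
  have h2 := y.u1 b a
  have h3 := x.u2 b a
  have h4 := y.u2 b a
  grind

/-- A set containing the flow of x and y up to a common time. -/
theorem joined {s : Set (XS d)} {x y : XS d} {t : ℝ} (ht : 0 ≤ t)
    (hx : ∀ u, 0 ≤ u → u ≤ t → x.up u ∈ s) (hy : ∀ u, 0 ≤ u → u ≤ t → y.up u ∈ s)
    (h : x.up t = y.up t) : ∃ p ⊆ s, x ∈ p ∧ y ∈ p ∧ IsPreconnected p := by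
  refine ⟨(fun u => x.up u) '' Set.Icc 0 t ∪ (fun u => y.up u) '' Set.Icc 0 t, ?_, ?_, ?_, ?_⟩
  · rintro _ (⟨u, hu, rfl⟩ | ⟨u, hu, rfl⟩)
    · exact hx u hu.1 hu.2
    · exact hy u hu.1 hu.2
  · exact Or.inl ⟨0, ⟨le_rfl, ht⟩, x.up_zero⟩
  · exact Or.inr ⟨0, ⟨le_rfl, ht⟩, y.up_zero⟩
  · apply IsPreconnected.union (x.up t)
    · exact ⟨t, ⟨ht, le_rfl⟩, rfl⟩
    · exact ⟨t, ⟨ht, le_rfl⟩, h.symm⟩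
    · exact isPreconnected_Icc.image _ x.up_cont.continuousOn
    · exact isPreconnected_Icc.image _ y.up_cont.continuousOn

theorem preconn_lt (a : M) {r : ℝ} : IsPreconnected {x : XS d | x a < r} := by
  apply isPreconnected_of_forall_pair
  intro x hx y hy
  simp only [Set.mem_ofPred_eq] at hx hy
  apply joined (t := max (x a) (y a))
  · exact le_max_of_le_left (x.nonneg a)
  · intro u h0 hu
    have : u ≤ 1 := hu.trans (max_le (x.le1 _) (y.le1 _))
    simp only [Set.mem_ofPred_eq, up_apply _ this]
    grind
  · intro u h0 hu
    have : u ≤ 1 := hu.trans (max_le (x.le1 _) (y.le1 _))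
    simp only [Set.mem_ofPred_eq, up_apply _ this]
    grind
  · exact up_eq (a := a) x y (max_le (x.le1 _) (y.le1 _)) (le_max_left _ _) (le_max_right _ _)

theorem preconn_gt (a : M) {r : ℝ} : IsPreconnected {x : XS d | r < x a} := by
  apply isPreconnected_of_forall_pair
  intro x hx y hy
  simp only [Set.mem_ofPred_eq] at hx hy
  apply joined (t := 1)
  · exact zero_le_one
  · intro u h0 hu
    simp only [Set.mem_ofPred_eq, up_apply _ hu]
    grind
  · intro u h0 hu
    simp only [Set.mem_ofPred_eq, up_apply _ hu]
    grind
  · exact up_one _ _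

theorem preconn_ge (a : M) {r : ℝ} : IsPreconnected {x : XS d | r ≤ x a} := by
  apply isPreconnected_of_forall_pair
  intro x hx y hy
  simp only [Set.mem_ofPred_eq] at hx hy
  apply joined (t := 1)
  · exact zero_le_one
  · intro u h0 hu
    simp only [Set.mem_ofPred_eq, up_apply _ hu]
    grind
  · intro u h0 hu
    simp only [Set.mem_ofPred_eq, up_apply _ hu]
    grind
  · exact up_one _ _

instance : PreconnectedSpace (XS d) := by
  constructor
  apply isPreconnected_of_forall_pair
  intro x hx y hy
  apply joined (t := 1)
  · exact zero_le_one
  · simp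
  · simp
  · exact up_one _ _

/-- basic neighbourhoods -/
def nb (x : XS d) (I : Finset M) (ε : ℝ) : Set (XS d) := {y | ∀ a ∈ I, |y a - x a| < ε}

theorem nb_open (x : XS d) (I : Finset M) (ε : ℝ) : IsOpen (nb x I ε) := by
  have : nb x I ε = ⋂ a ∈ I, {y : XS d | |y a - x a| < ε} := by
    ext y; simp [nb]
  rw [this]
  apply isOpen_biInter_finset
  intro a _
  exact isOpen_lt (((cont a).sub continuous_const).abs) continuous_const

theorem exists_nb {x : XS d} {s : Set (XS d)} (hs : s ∈ 𝓝 x) :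
    ∃ I : Finset M, ∃ ε > 0, nb x I ε ⊆ s := by
  rw [val_inducing.nhds_eq_comap, mem_comap] at hs
  obtain ⟨t, ht, hts⟩ := hs
  rw [nhds_pi, Filter.mem_pi] at ht
  obtain ⟨I, hI, u, hu, hut⟩ := ht
  have : ∀ a, ∃ ε > 0, Metric.ball (x.1 a) ε ⊆ u a := fun a => Metric.mem_nhds_iff.mp (hu a)
  choose e he heu using this
  obtain ⟨δ, hδ, hδe⟩ : ∃ δ > 0, ∀ a ∈ hI.toFinset, δ ≤ e a := by
    rcases hI.toFinset.eq_empty_or_nonempty with h | h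
    · exact ⟨1, one_pos, by simp [h]⟩
    · obtain ⟨b, hb, hb'⟩ := hI.toFinset.exists_min_image e h
      exact ⟨e b, he b, hb'⟩
  refine ⟨hI.toFinset, δ, hδ, fun y hy => hts (hut ?_)⟩
  intro a ha
  apply heu
  have := hy a (by simpa using ha)
  have h2 := hδe a (by simpa using ha)
  simp only [Metric.mem_ball, Real.dist_eq]
  exact lt_of_lt_of_le this h2

theorem nb_preconn (x : XS d) (I : Finset M) {ε : ℝ} (hε : 0 < ε) : IsPreconnected (nb x I ε) := by
  rcases I.eq_empty_or_nonempty with h | h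
  · subst h
    have : nb x ∅ ε = Set.univ := by ext; simp [nb]
    rw [this]
    exact isPreconnected_univ
  obtain ⟨a, ha, hmin⟩ := I.exists_min_image (fun a => x a) h
  apply isPreconnected_of_forall x
  intro y hy
  have hya := hy a ha
  rw [abs_lt] at hya
  apply joined (t := max (x a) (y a))
  · exact le_max_of_le_left (x.nonneg a)
  · intro u h0 hu b hb
    have : u ≤ 1 := hu.trans (max_le (x.le1 _) (y.le1 _))
    rw [up_apply _ this, abs_lt]
    have := hmin b hb
    grind
  · intro u h0 hu b hb
    have : u ≤ 1 := hu.trans (max_le (x.le1 _) (y.le1 _))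
    rw [up_apply _ this, abs_lt]
    have := hmin b hb
    have h3 := hy b hb
    rw [abs_lt] at h3
    grind
  · exact up_eq (a := a) x y (max_le (x.le1 _) (y.le1 _)) (le_max_left _ _) (le_max_right _ _)

theorem self_mem_nb (x : XS d) (I : Finset M) {ε : ℝ} (hε : 0 < ε) : x ∈ nb x I ε := by
  intro a _
  simpa using hε

instance : LocallyConnectedSpace (XS d) := by
  rw [locallyConnectedSpace_iff_subsets_isOpen_isConnected]
  intro x s hs
  obtain ⟨I, ε, hε, h⟩ := exists_nb hs
  exact ⟨nb x I ε, h, nb_open _ _ _, self_mem_nb x I hε, ⟨x, self_mem_nb x I hε⟩, nb_preconn x I hε⟩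

/-- dense distances avoiding a finite set -/
theorem dense_avoid (hd : UM d) (a : M) (T : Finset ℝ) {α β : ℝ} (h0 : 0 ≤ α) (h : α < β) (h1 : β ≤ 1) :
    ∃ c, α < d a c ∧ d a c < β ∧ d a c ∉ T := by
  induction T using Finset.induction_on generalizing α with
  | empty =>
    obtain ⟨c, h2, h3⟩ := hd.dense a α β h0 h h1
    exact ⟨c, h2, h3, by simp⟩
  | insert t T _ ih =>
    by_cases htβ : α < t ∧ t < β
    · obtain ⟨c, h2, h3, h4⟩ := ih (h0.trans htβ.1.le) htβ.2
      refine ⟨c, htβ.1.trans h2, h3, ?_⟩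
      rw [Finset.mem_insert]
      rintro (h | h)
      · exact h2.ne' h
      · exact h4 h
    · obtain ⟨c, h2, h3, h4⟩ := ih h0 h
      refine ⟨c, h2, h3, ?_⟩
      rw [Finset.mem_insert]
      rintro (h | h)
      · exact htβ ⟨h ▸ h2, h ▸ h3⟩
      · exact h4 h

theorem dense_io (hd : UM d) [Nonempty M] : Dense (Set.range (io hd)) := by
  intro x
  rw [mem_closure_iff_nhds]
  intro s hs
  obtain ⟨I, ε, hε, h⟩ := exists_nb hs
  suffices ∃ c, io hd c ∈ nb x I ε by
    obtain ⟨c, hc⟩ := this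
    exact ⟨_, h hc, c, rfl⟩
  rcases I.eq_empty_or_nonempty with h | h
  · subst h
    exact ⟨Classical.arbitrary M, by simp [nb]⟩
  obtain ⟨a, ha, hmin⟩ := I.exists_min_image (fun a => x a) h
  have hx0 := x.nonneg a
  have hx1 := x.le1 a
  obtain ⟨c, h1, h2, h3⟩ := dense_avoid hd a (I.image (fun b => d a b)) (α := max 0 (x a - ε))
    (β := min 1 (x a + ε)) (le_max_left _ _) (by grind) (min_le_left _ _)
  refine ⟨c, fun b hb => ?_⟩
  have hne : d a c ≠ d a b := fun e => h3 (by rw [e]; exact Finset.mem_image_of_mem _ hb)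
  have e1 := hd.ult c a b
  have e2 := hd.ult a c b
  have e3 := hd.ult a b c
  have e4 := hd.symm c a
  have e5 := hd.symm c b
  have e6 := x.u1 b a
  have e7 := x.u2 a b
  have e8 := hmin b hb
  have e9 := hd.symm b a
  rw [io_apply, abs_lt]
  grind

theorem closure_lt_subset {a : M} {r : ℝ} (hd : UM d) (hr : r ≤ 1) {x : XS d}
    (hx : x ∈ frontier {x : XS d | x a < r}) : x = (io hd a).up r := by
  have hO : IsOpen {x : XS d | x a < r} := isOpen_lt (cont a) continuous_const
  rw [hO.frontier_eq] at hx
  obtain ⟨hx1, hx2⟩ := hx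
  simp only [Set.mem_ofPred_eq, not_lt] at hx2
  have hge : ∀ e, r ≤ x e := by
    intro e
    by_contra! he
    rw [mem_closure_iff] at hx1
    obtain ⟨y, hy1, hy2⟩ := hx1 {y | y e < r} (isOpen_lt (cont e) continuous_const) he
    simp only [Set.mem_ofPred_eq] at hy1 hy2
    have h1 := y.u2 a e
    have h2 := x.u1 a e
    grind
  have hle : x a ≤ r := by
    have : closure {x : XS d | x a < r} ⊆ {x : XS d | x a ≤ r} :=
      closure_minimal (fun x hx => by simp only [Set.mem_ofPred_eq] at hx ⊢; exact hx.le) (isClosed_le (cont a) continuous_const)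
    exact this hx1
  have h0 : 0 ≤ r := (x.nonneg a).trans hle
  rw [← up_eq x (io hd a) hr hle (by simpa [hd.self] using h0)]
  apply ext'
  intro b
  rw [up_apply _ hr, max_eq_left (hge b)]

theorem closure_gt_subset {a : M} {r : ℝ} (hd : UM d) (hr : r ≤ 1) {x : XS d}
    (hx : x ∈ frontier {x : XS d | r < x a}) : x = (io hd a).up r := by
  have hO : IsOpen {x : XS d | r < x a} := isOpen_lt continuous_const (cont a)
  rw [hO.frontier_eq] at hx
  obtain ⟨hx1, hle⟩ := hx
  simp only [Set.mem_ofPred_eq, not_lt] at hle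
  have hx2 : r ≤ x a := by
    have : closure {x : XS d | r < x a} ⊆ {x : XS d | r ≤ x a} :=
      closure_minimal (fun x hx => by simp only [Set.mem_ofPred_eq] at hx ⊢; exact hx.le) (isClosed_le continuous_const (cont a))
    exact this hx1
  have hge : ∀ e, r ≤ x e := by
    intro e
    by_contra! he
    rw [mem_closure_iff] at hx1
    obtain ⟨y, hy1, hy2⟩ := hx1 {y | y e < r} (isOpen_lt (cont e) continuous_const) he
    simp only [Set.mem_ofPred_eq] at hy1 hy2
    have h1 := y.u1 a e
    have h2 := x.u2 a e
    grind
  have h0 : 0 ≤ r := (x.nonneg a).trans hle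
  rw [← up_eq x (io hd a) hr hle (by simpa [hd.self] using h0)]
  apply ext'
  intro b
  rw [up_apply _ hr, max_eq_left (hge b)]

theorem subset_of_frontier {X : Type*} [TopologicalSpace X] {C B : Set X} (hC : IsPreconnected C)
    (hB : IsOpen B) (h : (C ∩ B).Nonempty) (hf : ∀ x ∈ frontier B, x ∉ C) : C ⊆ B := by
  apply hC.subset_left_of_subset_union hB (isClosed_closure (s := B)).isOpen_compl
  · exact Set.disjoint_compl_right_iff_subset.mpr subset_closure
  · intro x hx
    by_cases h1 : x ∈ B
    · exact Or.inl h1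
    · right
      intro h2
      exact hf x (by rw [hB.frontier_eq]; exact ⟨h2, h1⟩) hx
  · exact h

/-- Tree lemma -/
theorem tree (hd : UM d) [Nonempty M] {C V : Set (XS d)} (hC : IsClosed C) (hCc : IsPreconnected C)
    (b : M) (hb : io hd b ∈ C) (hVo : IsOpen V) (hVc : IsPreconnected V) (hVn : V.Nonempty)
    (hVC : ∀ x ∈ V, x ∉ C)
    (hmax : ∀ D : Set (XS d), IsPreconnected D → (∀ x ∈ D, x ∉ C) → (D ∩ V).Nonempty → D ⊆ V) :
    (∃ a r, 0 < r ∧ r ≤ 1 ∧ V = {x : XS d | x a < r}) ∨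
    (∃ a r, 0 ≤ r ∧ r < 1 ∧ V = {x : XS d | r < x a}) := by
  set g := (io hd b).up 1 with hg
  by_cases hgV : g ∈ V
  · right
    have hK : IsCompact (Set.Icc (0:ℝ) 1 ∩ (fun t => (io hd b).up t) ⁻¹' C) :=
      isCompact_Icc.inter_right (hC.preimage (up_cont _))
    obtain ⟨t, ⟨ht, htC⟩, hmx⟩ := hK.exists_isGreatest ⟨0, ⟨le_rfl, zero_le_one⟩, by
      simpa [up_zero] using hb⟩
    simp only [Set.mem_preimage] at htC
    have ht1 : t < 1 := by
      apply lt_of_le_of_ne ht.2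
      rintro rfl
      exact hVC _ hgV htC
    have hCt : ∀ x ∈ C, x b ≤ t := by
      intro x hx
      by_contra! hlt
      have hn : (io hd b).up (x b) ∉ C := by
        intro h
        exact absurd (hmx ⟨⟨x.nonneg b, x.le1 b⟩, h⟩) (not_le.mpr hlt)
      have hup : x.up (x b) = (io hd b).up (x b) :=
        up_eq (a := b) _ _ (x.le1 b) le_rfl (by simpa [hd.self] using x.nonneg b)
      obtain ⟨e, he⟩ : ∃ e, x e < x b := by
        by_contra! hall
        apply hn
        rw [← hup]
        have : x.up (x b) = x := by
          apply ext'
          intro c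
          rw [up_apply _ (x.le1 b), max_eq_left (hall c)]
        rwa [this]
      have hsub : C ⊆ {y : XS d | y e < x b} := by
        apply subset_of_frontier hCc (isOpen_lt (cont e) continuous_const) ⟨x, hx, he⟩
        intro y hy hyC
        have h1 := closure_lt_subset hd (x.le1 b) hy
        rw [h1] at hyC
        apply hn
        rw [← hup, up_eq (a := e) x (io hd e) (x.le1 b) he.le (by simpa [hd.self] using x.nonneg b)]
        exact hyC
      have h2 := hsub hb
      simp only [Set.mem_ofPred_eq, io_apply] at h2
      have h3 := x.u1 b e
      grind
    refine ⟨b, t, ht.1, ht1, ?_⟩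
    apply Set.Subset.antisymm
    · apply subset_of_frontier hVc (isOpen_lt continuous_const (cont b))
      · refine ⟨g, hgV, ?_⟩
        simp only [Set.mem_ofPred_eq, hg, up_apply _ le_rfl]
        exact lt_of_lt_of_le ht1 (le_max_right _ _)
      · intro y hy hyV
        rw [closure_gt_subset hd ht1.le hy] at hyV
        exact hVC _ hyV htC
    · apply hmax _ (preconn_gt b)
      · intro x hx hxC
        exact absurd (hCt x hxC) (not_le.mpr hx)
      · refine ⟨g, ?_, hgV⟩
        simp only [Set.mem_ofPred_eq, hg, up_apply _ le_rfl]
        exact lt_of_lt_of_le ht1 (le_max_right _ _)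
  · left
    obtain ⟨_, haV, a, rfl⟩ := (dense_io hd).inter_open_nonempty V hVo hVn
    obtain ⟨c0, hc0, hmin⟩ := hC.isCompact.exists_isMinOn ⟨_, hb⟩ (cont a).continuousOn
    have hmin' : ∀ c ∈ C, c0 a ≤ c a := fun c hc => hmin hc
    have hr0 : 0 < c0 a := by
      apply lt_of_le_of_ne (c0.nonneg a)
      intro h
      rw [eq_io hd h.symm] at hc0
      exact hVC _ haV hc0
    have hr1 := c0.le1 a
    have hup : c0.up (c0 a) = (io hd a).up (c0 a) :=
        up_eq (a := a) _ _ hr1 le_rfl (by simpa [hd.self] using c0.nonneg a)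
    have hS : (io hd a).up (c0 a) ∈ C := by
      by_contra hn
      obtain ⟨e, he⟩ : ∃ e, c0 e < c0 a := by
        by_contra! hall
        apply hn
        rw [← hup]
        have : c0.up (c0 a) = c0 := by
          apply ext'
          intro c
          rw [up_apply _ hr1, max_eq_left (hall c)]
        rwa [this]
      have hsub : C ⊆ {y : XS d | y e < c0 a} := by
        apply subset_of_frontier hCc (isOpen_lt (cont e) continuous_const) ⟨c0, hc0, he⟩
        intro y hy hyC
        have h1 := closure_lt_subset hd hr1 hy
        rw [h1] at hyC
        apply hn
        rw [← hup, up_eq (a := e) c0 (io hd e) hr1 he.le (by simpa [hd.self] using c0.nonneg a)]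
        exact hyC
      apply hgV
      have hDV : {x : XS d | c0 a ≤ x e} ⊆ V := by
        apply hmax _ (preconn_ge e)
        · intro x hx hxC
          exact absurd (show x e < c0 a from hsub hxC) (not_lt.mpr hx)
        · refine ⟨io hd a, ?_, haV⟩
          simp only [Set.mem_ofPred_eq, io_apply]
          have := c0.u1 a e
          grind
      apply hDV
      simp only [Set.mem_ofPred_eq, hg, up_apply _ le_rfl]
      exact le_max_of_le_right hr1
    refine ⟨a, c0 a, hr0, hr1, ?_⟩
    apply Set.Subset.antisymm
    · apply subset_of_frontier hVc (isOpen_lt (cont a) continuous_const)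
      · exact ⟨io hd a, haV, by simpa [hd.self] using hr0⟩
      · intro y hy hyV
        rw [closure_lt_subset hd hr1 hy] at hyV
        exact hVC _ hyV hS
    · apply hmax _ (preconn_lt a)
      · intro x hx hxC
        exact absurd (hmin' x hxC) (not_le.mpr hx)
      · exact ⟨io hd a, by simpa [hd.self] using hr0, haV⟩

end XS


namespace XS

variable {M : Type*} {d : M → M → ℝ}

/-- Domains on which zero-free functions have modulus a power of h. -/
structure Good (hd : UM d) (V : Set (XS d)) (h : XS d → ℝ) : Prop where
  cont : Continuous h
  pos : ∀ x ∈ V, 0 < h x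
  p1 : ∀ x : M, io hd x ∉ V → ∃ c > 0, ∀ w, io hd w ∈ V → d w x = c * h (io hd w)
  p2 : ∀ v ∈ V, ∀ s : Finset M, (∀ x ∈ s, io hd x ∈ V) →
    ∃ w, io hd w ∈ V ∧ ∀ x ∈ s, v x * h (io hd w) < d w x * h v

theorem finset_bound (s : Finset M) (g : M → ℝ) {r : ℝ} (hr : 0 < r) (h : ∀ x ∈ s, g x < r) :
    ∃ α, 0 ≤ α ∧ α < r ∧ ∀ x ∈ s, g x ≤ α := by
  induction s using Finset.induction_on with
  | empty => exact ⟨0, le_rfl, hr, by simp⟩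
  | insert a s _ ih =>
    obtain ⟨α, h0, h1, h2⟩ := ih (fun x hx => h x (Finset.mem_insert_of_mem hx))
    refine ⟨max α (g a), le_max_of_le_left h0, max_lt h1 (h a (Finset.mem_insert_self _ _)), ?_⟩
    intro x hx
    rcases Finset.mem_insert.mp hx with rfl | hx
    · exact le_max_right _ _
    · exact le_max_of_le_left (h2 x hx)

theorem finset_bound' (s : Finset M) (g : M → ℝ) {r c : ℝ} (hr : r < c) (h : ∀ x ∈ s, r < g x) :
    ∃ β, r < β ∧ β ≤ c ∧ ∀ x ∈ s, β ≤ g x := by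
  induction s using Finset.induction_on with
  | empty => exact ⟨c, hr, le_rfl, by simp⟩
  | insert a s _ ih =>
    obtain ⟨α, h0, h1, h2⟩ := ih (fun x hx => h x (Finset.mem_insert_of_mem hx))
    refine ⟨min α (g a), lt_min h0 (h a (Finset.mem_insert_self _ _)), min_le_of_left_le h1, ?_⟩
    intro x hx
    rcases Finset.mem_insert.mp hx with rfl | hx
    · exact min_le_right _ _
    · exact min_le_of_left_le (h2 x hx)

theorem good_lt (hd : UM d) {a : M} {r : ℝ} (hr : 0 < r) (hr1 : r ≤ 1) :
    Good hd {x : XS d | x a < r} (fun _ => 1) where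
  cont := continuous_const
  pos _ _ := one_pos
  p1 x hx := by
    simp only [Set.mem_ofPred_eq, io_apply, not_lt] at hx
    refine ⟨d x a, hr.trans_le hx, ?_⟩
    intro w hw
    simp only [Set.mem_ofPred_eq, io_apply] at hw
    have h1 := hd.ult w a x
    have h2 := hd.ult x w a
    have h3 := hd.symm x w
    have h4 := hd.symm x a
    grind
  p2 v hv s hs := by
    simp only [Set.mem_ofPred_eq, io_apply] at hv hs
    obtain ⟨α, h0, h1, h2⟩ := finset_bound s (fun x => max (v x) (d x a)) hr (by
      intro x hx
      have e1 := hs x hx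
      have e2 := v.u1 x a
      grind)
    obtain ⟨w, h3, h4⟩ := hd.dense a α r h0 h1 hr1
    refine ⟨w, by simpa [hd.symm w a] using h4, ?_⟩
    intro x hx
    have e1 := h2 x hx
    have e2 := hd.ult a x w
    have e3 := hd.symm x w
    have e4 := hd.symm x a
    grind

theorem good_gt (hd : UM d) {b : M} {t : ℝ} (ht : 0 ≤ t) (ht1 : t < 1) :
    Good hd {x : XS d | t < x b} (fun x => x b) where
  cont := XS.cont b
  pos x hx := lt_of_le_of_lt ht hx
  p1 x hx := by
    simp only [Set.mem_ofPred_eq, io_apply, not_lt] at hx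
    refine ⟨1, one_pos, ?_⟩
    intro w hw
    simp only [Set.mem_ofPred_eq, io_apply] at hw
    have h1 := hd.ult w b x
    have h2 := hd.ult w x b
    have h4 := hd.symm x b
    simp only [io_apply]
    grind
  p2 v hv s hs := by
    simp only [Set.mem_ofPred_eq, io_apply] at hv hs
    obtain ⟨β, h0, h1, h2⟩ := finset_bound' s (fun x => d x b) hv hs
    obtain ⟨w, h3, h4⟩ := hd.dense b t β ht h0 (h1.trans (v.le1 _))
    refine ⟨w, by simpa [hd.symm w b] using h3, ?_⟩
    intro x hx
    have e1 := h2 x hx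
    have e2 := hd.ult w b x
    have e3 := hd.ult b w x
    have e4 := hd.symm x b
    have e5 := hd.symm w b
    have e6 := v.u1 x b
    have e7 : d w x = d x b := by grind
    simp only [io_apply]
    rw [e7, e5]
    have hw : d b w < v b := h4.trans_le h1
    have hw' : d b w < d x b := h4.trans_le e1
    have hp := hd.nonneg b w
    rcases le_max_iff.mp e6 with h | h
    · nlinarith
    · nlinarith

/-- Factorisation property of rational functions. -/
structure Fac (d : M → M → ℝ) (f : M → M) (n : ℕ) (N : M → ℝ) : Prop where
  npos : ∀ w, 0 < N w
  fac : ∀ y, ∃ c > 0, ∃ x : Fin n → M, ∀ w, d (f w) y * N w = c * ∏ i, d w (x i)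

theorem Fac.root {f : M → M} {n : ℕ} {N : M → ℝ} (hd : UM d) (hN : Fac d f n N) {y : M} {c : ℝ} (hc : 0 < c)
    {x : Fin n → M} (h : ∀ w, d (f w) y * N w = c * ∏ i, d w (x i)) (w : M) :
    f w = y ↔ ∃ i, w = x i := by
  constructor
  · rintro rfl
    have := h w
    rw [hd.self, zero_mul] at this
    have := (mul_eq_zero.mp this.symm).resolve_left hc.ne'
    obtain ⟨i, _, hi⟩ := Finset.prod_eq_zero_iff.mp this
    exact ⟨i, hd.eq _ _ hi⟩
  · rintro ⟨i, rfl⟩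
    have := h (x i)
    rw [Finset.prod_eq_zero (Finset.mem_univ i) (hd.self _), mul_zero] at this
    exact hd.eq _ _ ((mul_eq_zero.mp this).resolve_right (hN.npos _).ne')

theorem open_aux [Nonempty M] (hd : UM d) {f : M → M} {n : ℕ} {N : M → ℝ} (hN : Fac d f n N)
    {F : XS d → XS d} (hF : Continuous F) (hFf : ∀ w, F (io hd w) = io hd (f w))
    {V : Set (XS d)} {h : XS d → ℝ} (hV : IsOpen V) (hg : Good hd V h) {v : XS d} (hv : v ∈ V)
    (hcl : F v ∈ closure (io hd '' {y | ∀ w, io hd w ∈ V → f w ≠ y})) : False := by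
  obtain ⟨w0, hw0V, hw0⟩ : ∃ w0, io hd w0 ∈ V ∧ io hd (f w0) ≠ F v := by
    by_cases hq : ∃ q0, F v = io hd q0
    · obtain ⟨q0, hq0⟩ := hq
      obtain ⟨c, hc, x, hx⟩ := hN.fac q0
      obtain ⟨w, hw, hwx⟩ := hg.p2 v hv ((Finset.univ.image x).filter (fun y => io hd y ∈ V))
        (by intro y hy; exact (Finset.mem_filter.mp hy).2)
      refine ⟨w, hw, ?_⟩
      rw [hq0]
      intro he
      have he' : f w = q0 := by
        apply hd.eq
        have : io hd (f w) q0 = io hd q0 q0 := by rw [he]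
        simpa [hd.self] using this
      obtain ⟨i, hi⟩ := (hN.root hd hc hx w).mp he'
      have := hwx (x i) (Finset.mem_filter.mpr ⟨Finset.mem_image_of_mem _ (Finset.mem_univ i), hi ▸ hw⟩)
      rw [← hi, hd.self, zero_mul] at this
      exact absurd this (not_lt.mpr (mul_nonneg (v.nonneg _) (hg.pos _ hw).le))
    · obtain ⟨_, haV, a, rfl⟩ := (dense_io hd).inter_open_nonempty V hV ⟨v, hv⟩
      exact ⟨a, haV, fun e => hq ⟨_, e.symm⟩⟩
  set p0 := f w0 with hp0
  set q := F v with hqdef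
  have hqp0 : 0 < q p0 := by
    apply lt_of_le_of_ne (q.nonneg _)
    intro e
    exact hw0 (eq_io hd e.symm).symm
  obtain ⟨c, hc, x, hx⟩ := hN.fac p0
  obtain ⟨i0, hi0⟩ := (hN.root hd hc hx w0).mp rfl
  obtain ⟨w, hw, hwx⟩ := hg.p2 v hv ((Finset.univ.image x).filter (fun y => io hd y ∈ V))
        (by intro y hy; exact (Finset.mem_filter.mp hy).2)
  have hwx' : ∀ i, io hd (x i) ∈ V → v (x i) * h (io hd w) < d w (x i) * h v := fun i hi =>
    hwx _ (Finset.mem_filter.mpr ⟨Finset.mem_image_of_mem _ (Finset.mem_univ i), hi⟩)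
  -- the product function
  set G : XS d → ℝ := fun z => ∏ i, (if io hd (x i) ∈ V then z (x i) else h z) with hG
  have hGc : Continuous G := by
    apply continuous_finsetProd
    intro i _
    split_ifs
    · exact cont _
    · exact hg.cont
  have hGnn : 0 ≤ G v := by
    apply Finset.prod_nonneg
    intro i _
    split_ifs
    · exact v.nonneg _
    · exact (hg.pos _ hv).le
  have hGlt : G v * h (io hd w) ^ n < G (io hd w) * h v ^ n := by
    have e1 : G v * h (io hd w) ^ n =
        ∏ i, ((if io hd (x i) ∈ V then v (x i) else h v) * h (io hd w)) := by
      rw [Finset.prod_mul_distrib]; simp [hG]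
    have e2 : G (io hd w) * h v ^ n =
        ∏ i, ((if io hd (x i) ∈ V then d w (x i) else h (io hd w)) * h v) := by
      rw [Finset.prod_mul_distrib]; simp [hG]
    rw [e1, e2]
    have hvp := hg.pos _ hv
    have hwp := hg.pos _ hw
    have hle : ∀ i, (if io hd (x i) ∈ V then v (x i) else h v) * h (io hd w) ≤
        (if io hd (x i) ∈ V then d w (x i) else h (io hd w)) * h v := by
      intro i
      by_cases hi : io hd (x i) ∈ V
      · simp only [hi, if_true]; exact (hwx' i hi).le
      · simp only [hi, if_false]; rw [mul_comm]
    have hrp : ∀ i, 0 < (if io hd (x i) ∈ V then d w (x i) else h (io hd w)) * h v := by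
      intro i
      by_cases hi : io hd (x i) ∈ V
      · simp only [hi, if_true]
        exact lt_of_le_of_lt (mul_nonneg (v.nonneg _) hwp.le) (hwx' i hi)
      · simp only [hi, if_false]
        positivity
    have hln : ∀ i, 0 ≤ (if io hd (x i) ∈ V then v (x i) else h v) * h (io hd w) := by
      intro i
      apply mul_nonneg _ hwp.le
      split_ifs
      · exact v.nonneg _
      · exact hvp.le
    by_cases hz : ∀ i, 0 < (if io hd (x i) ∈ V then v (x i) else h v) * h (io hd w)
    · apply Finset.prod_lt_prod (fun i _ => hz i) (fun i _ => hle i)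
      refine ⟨i0, Finset.mem_univ _, ?_⟩
      have : io hd (x i0) ∈ V := hi0 ▸ hw0V
      simp only [this, if_true]
      exact hwx' i0 this
    · push Not at hz
      obtain ⟨i, hi⟩ := hz
      rw [Finset.prod_eq_zero (Finset.mem_univ i) (le_antisymm hi (hln i))]
      exact Finset.prod_pos (fun i _ => hrp i)
  -- formula for p0
  obtain ⟨A, hA, hAeq⟩ : ∃ A > 0, ∀ z, io hd z ∈ V → d (f z) p0 * N z = A * G (io hd z) := by
    have : ∀ i, ∃ k > 0, ∀ z, io hd z ∈ V →
        d z (x i) = k * (if io hd (x i) ∈ V then d z (x i) else h (io hd z)) := by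
      intro i
      by_cases hi : io hd (x i) ∈ V
      · exact ⟨1, one_pos, fun z _ => by simp [hi]⟩
      · obtain ⟨k, hk, hk'⟩ := hg.p1 _ hi
        exact ⟨k, hk, fun z hz => by simp only [hi, if_false]; exact hk' z hz⟩
    choose k hk hk' using this
    refine ⟨c * ∏ i, k i, mul_pos hc (Finset.prod_pos fun i _ => hk i), fun z hz => ?_⟩
    rw [hx z, mul_assoc]
    congr 1
    rw [hG]
    simp only [io_apply]
    rw [← Finset.prod_mul_distrib]
    exact Finset.prod_congr rfl fun i _ => hk' i z hz
  set E := {y | ∀ w, io hd w ∈ V → f w ≠ y} with hE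
  have hB : ∀ y ∈ E, ∃ B > 0, ∀ z, io hd z ∈ V → d (f z) y * N z = B * h (io hd z) ^ n := by
    intro y hy
    obtain ⟨c', hc', x', hx'⟩ := hN.fac y
    have : ∀ i, ∃ k > 0, ∀ z, io hd z ∈ V → d z (x' i) = k * h (io hd z) := by
      intro i
      apply hg.p1
      intro hi
      exact hy _ hi ((hN.root hd hc' hx' _).mpr ⟨i, rfl⟩)
    choose k hk hk' using this
    refine ⟨c' * ∏ i, k i, mul_pos hc' (Finset.prod_pos fun i _ => hk i), fun z hz => ?_⟩
    rw [hx' z, mul_assoc]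
    congr 1
    rw [Finset.prod_congr rfl fun i _ => hk' i z hz, Finset.prod_mul_distrib]
    simp
  set p := f w with hp
  have key : ∀ y ∈ E, d p p0 * q y * (G v * h (io hd w) ^ n) =
      d p y * q p0 * (G (io hd w) * h v ^ n) := by
    intro y hy
    obtain ⟨B, hBp, hB⟩ := hB y hy
    have hclosed : IsClosed {z : XS d | d p p0 * F z y * (G z * h (io hd w) ^ n) =
      d p y * F z p0 * (G (io hd w) * h z ^ n)} := by
      apply isClosed_eq
      · exact (continuous_const.mul ((cont y).comp hF)).mul (hGc.mul continuous_const)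
      · exact (continuous_const.mul ((cont p0).comp hF)).mul (continuous_const.mul (hg.cont.pow n))
    have hsub : closure (V ∩ Set.range (io hd)) ⊆ {z : XS d | d p p0 * F z y * (G z * h (io hd w) ^ n) =
      d p y * F z p0 * (G (io hd w) * h z ^ n)} := by
      apply closure_minimal _ hclosed
      rintro _ ⟨hz, z, rfl⟩
      simp only [Set.mem_ofPred_eq, hFf, io_apply]
      have a1 := hAeq w hw
      have a2 := hAeq z hz
      have a3 := hB w hw
      have a4 := hB z hz
      have n1 := (hN.npos w).ne'
      have n2 := (hN.npos z).ne'
      apply mul_right_cancel₀ (mul_ne_zero n1 n2)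
      calc d p p0 * d (f z) y * (G (io hd z) * h (io hd w) ^ n) * (N w * N z)
          = (d p p0 * N w) * (d (f z) y * N z) * (G (io hd z) * h (io hd w) ^ n) := by ring
        _ = (d p y * N w) * (d (f z) p0 * N z) * (G (io hd w) * h (io hd z) ^ n) := by
            rw [a1, a2, a3, a4]; ring
        _ = _ := by ring
    have := hsub ((dense_io hd).open_subset_closure_inter hV hv)
    exact this
  set a := G v * h (io hd w) ^ n
  set b := G (io hd w) * h v ^ n
  have ha : 0 ≤ a := mul_nonneg hGnn (pow_nonneg (hg.pos _ hw).le _)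
  rcases (q.nonneg p).eq_or_lt with hqp | hqp
  · have hq := eq_io hd hqp.symm
    obtain ⟨_, hy⟩ : (io hd '' E).Nonempty := closure_nonempty_iff.mp ⟨_, hcl⟩
    obtain ⟨y, hyE, -⟩ := hy
    have := key y hyE
    rw [hq] at this hqp0
    simp only [io_apply] at this hqp0
    have hpy : 0 < d p y := by
      apply lt_of_le_of_ne (hd.nonneg _ _)
      intro e
      exact hyE w hw (hd.eq _ _ e.symm)
    have h2 : 0 < d p p0 * d p y := mul_pos hqp0 hpy
    nlinarith
  · have t1 : q p * q p0 * b ≤ d p p0 * a * max (q p) (q p) := by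
      have hcl1 : IsClosed {z : XS d | z p * q p0 * b ≤ d p p0 * a * max (q p) (z p)} :=
        isClosed_le (((cont p).mul continuous_const).mul continuous_const)
          (continuous_const.mul (continuous_const.max (cont p)))
      have : io hd '' E ⊆ {z : XS d | z p * q p0 * b ≤ d p p0 * a * max (q p) (z p)} := by
        rintro _ ⟨y, hy, rfl⟩
        simp only [Set.mem_ofPred_eq, io_apply]
        rw [hd.symm y p, ← key y hy]
        have := q.u1 y p
        rw [hd.symm y p] at this
        calc _ = d p p0 * a * q y := by ring
          _ ≤ _ := mul_le_mul_of_nonneg_left this (mul_nonneg (hd.nonneg _ _) ha)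
      exact closure_minimal this hcl1 hcl
    have t2 : q p * q p0 * b ≤ d p p0 * a * max (q p0) (q p0) := by
      have hcl1 : IsClosed {z : XS d | z p * q p0 * b ≤ d p p0 * a * max (q p0) (z p0)} :=
        isClosed_le (((cont p).mul continuous_const).mul continuous_const)
          (continuous_const.mul (continuous_const.max (cont p0)))
      have : io hd '' E ⊆ {z : XS d | z p * q p0 * b ≤ d p p0 * a * max (q p0) (z p0)} := by
        rintro _ ⟨y, hy, rfl⟩
        simp only [Set.mem_ofPred_eq, io_apply]
        rw [hd.symm y p, ← key y hy]
        have := q.u1 y p0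
        calc _ = d p p0 * a * q y := by ring
          _ ≤ _ := mul_le_mul_of_nonneg_left this (mul_nonneg (hd.nonneg _ _) ha)
      exact closure_minimal this hcl1 hcl
    rw [max_self] at t1 t2
    have s1 : q p0 * b ≤ d p p0 * a := by
      by_contra! hcon
      have := mul_lt_mul_of_pos_left hcon hqp
      linarith
    have s2 : q p * b ≤ d p p0 * a := by
      by_contra! hcon
      have := mul_lt_mul_of_pos_left hcon hqp0
      linarith
    have u := q.u2 p p0
    rcases le_max_iff.mp u with h' | h'
    · nlinarith
    · nlinarith

theorem main_abs [Nonempty M] (hd : UM d) {f : M → M} {n : ℕ} (hn : 0 < n) {N : M → ℝ} (hN : Fac d f n N)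
    {F : XS d → XS d} (hF : Continuous F) (hFf : ∀ w, F (io hd w) = io hd (f w))
    {J : Set (XS d)} (hJ : IsClosed J) (hJn : J.Nonempty) (hFJ : F ⁻¹' J = J)
    {u : XS d} (hu : u ∈ Jᶜ) (hinv : F ⁻¹' (connectedComponentIn Jᶜ u) ≠ connectedComponentIn Jᶜ u)
    (hfr : frontier (connectedComponentIn Jᶜ u) = J) :
    ∃ S, J = {S} ∧ ∀ a, S ≠ io hd a := by
  set U := connectedComponentIn Jᶜ u with hU
  have hFJ' : ∀ x, F x ∈ J ↔ x ∈ J := fun x => by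
    rw [← Set.mem_preimage, hFJ]
  have hUo : IsOpen U := hJ.isOpen_compl.connectedComponentIn
  have hUJ : U ⊆ Jᶜ := connectedComponentIn_subset _ _
  have huU : u ∈ U := mem_connectedComponentIn hu
  have hcl : closure U = U ∪ J := by
    rw [closure_eq_self_union_frontier, hfr]
  have hsurj : Function.Surjective F := by
    have h1 : IsClosed (Set.range F) := (isCompact_range hF).isClosed
    have h2 : Set.range (io hd) ⊆ Set.range F := by
      rintro _ ⟨y, rfl⟩
      obtain ⟨c, hc, x, hx⟩ := hN.fac y
      refine ⟨io hd (x ⟨0, hn⟩), ?_⟩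
      rw [hFf, (hN.root hd hc hx _).mpr ⟨_, rfl⟩]
    intro y
    exact closure_minimal h2 h1 (dense_io hd y)
  suffices hsub : J.Subsingleton by
    obtain ⟨S, hS⟩ := hJn
    have hJS : J = {S} := hsub.eq_singleton_of_mem hS
    refine ⟨S, hJS, ?_⟩
    rintro a rfl
    apply hinv
    have hJc : Jᶜ = {x : XS d | 0 < x a} := by
      ext x
      rw [hJS]
      simp only [Set.mem_compl_iff, Set.mem_singleton_iff, Set.mem_ofPred_eq]
      constructor
      · intro h
        exact lt_of_le_of_ne (x.nonneg a) (fun e => h (eq_io hd e.symm))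
      · rintro h rfl
        simp [hd.self] at h
    have : U = Jᶜ := by
      apply Set.Subset.antisymm hUJ
      apply IsPreconnected.subset_connectedComponentIn _ hu le_rfl
      rw [hJc]
      exact preconn_gt a
    rw [this, Set.preimage_compl, hFJ]
  -- structure of the other components
  have hcomp : ∀ v ∈ Jᶜ, v ∉ U → (∃ h, Good hd (connectedComponentIn Jᶜ v) h) ∧
      (frontier (connectedComponentIn Jᶜ v)).Subsingleton := by
    intro v hv hvU
    obtain ⟨_, hbU, b, rfl⟩ := (dense_io hd).inter_open_nonempty U hUo ⟨u, huU⟩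
    have := tree hd (C := closure U) (V := connectedComponentIn Jᶜ v) isClosed_closure
      isPreconnected_connectedComponentIn.closure b (subset_closure hbU)
      hJ.isOpen_compl.connectedComponentIn isPreconnected_connectedComponentIn
      ⟨v, mem_connectedComponentIn hv⟩ (by
        intro x hx hxc
        rw [hcl] at hxc
        rcases hxc with h | h
        · apply hvU
          rw [hU, connectedComponentIn_eq h, ← connectedComponentIn_eq hx]
          exact mem_connectedComponentIn hv
        · exact connectedComponentIn_subset _ _ hx h) (by
        rintro D hD hDC ⟨z, hzD, hzV⟩
        rw [connectedComponentIn_eq hzV]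
        apply hD.subset_connectedComponentIn hzD
        intro x hx hxJ
        exact hDC x hx (by rw [hcl]; exact Or.inr hxJ))
    rcases this with ⟨a, r, h0, h1, h2⟩ | ⟨a, r, h0, h1, h2⟩
    · rw [h2]
      refine ⟨⟨_, good_lt hd h0 h1⟩, fun x hx y hy => ?_⟩
      rw [closure_lt_subset hd h1 hx, closure_lt_subset hd h1 hy]
    · rw [h2]
      refine ⟨⟨_, good_gt hd h0 h1⟩, fun x hx y hy => ?_⟩
      rw [closure_gt_subset hd h1.le hx, closure_gt_subset hd h1.le hy]
  have hFcomp : ∀ x ∈ Jᶜ, F '' (connectedComponentIn Jᶜ x) ⊆ connectedComponentIn Jᶜ (F x) := by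
    intro x hx
    apply (isPreconnected_connectedComponentIn.image _ hF.continuousOn).subset_connectedComponentIn
    · exact ⟨x, mem_connectedComponentIn hx, rfl⟩
    · rintro _ ⟨z, hz, rfl⟩ h
      exact connectedComponentIn_subset _ _ hz ((hFJ' z).mp h)
  by_cases hFu : F u ∈ U
  · have hFU : U ⊆ F ⁻¹' U := by
      intro x hx
      rw [Set.mem_preimage, hU, connectedComponentIn_eq hFu]
      exact hFcomp u hu ⟨x, hx, rfl⟩
    obtain ⟨v, hvF, hvU⟩ : ∃ v, F v ∈ U ∧ v ∉ U := by
      by_contra! hcon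
      exact hinv (Set.Subset.antisymm hcon hFU)
    have hvJ : v ∈ Jᶜ := fun h => hUJ hvF ((hFJ' v).mpr h)
    obtain ⟨⟨h, hgood⟩, hfrV⟩ := hcomp v hvJ hvU
    set V := connectedComponentIn Jᶜ v with hV
    have hVo : IsOpen V := hJ.isOpen_compl.connectedComponentIn
    have hFV : ∀ x ∈ V, F x ∈ U := by
      intro x hx
      rw [hU, connectedComponentIn_eq hvF]
      exact hFcomp v hvJ ⟨x, hx, rfl⟩
    have hfrJ : ∀ x ∈ frontier V, x ∈ J := by
      intro x hx
      by_contra hxJ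
      rw [hVo.frontier_eq] at hx
      obtain ⟨z, hz1, hz2⟩ := mem_closure_iff.mp hx.1 _ (hJ.isOpen_compl.connectedComponentIn (x := x))
        (mem_connectedComponentIn hxJ)
      apply hx.2
      rw [hV, connectedComponentIn_eq hz2, ← connectedComponentIn_eq hz1]
      exact mem_connectedComponentIn hxJ
    have hAc : IsClosed (F '' closure V) := (isClosed_closure.isCompact.image hF).isClosed
    have hAU : ∀ z ∈ closure V, F z ∈ U → z ∈ V := by
      intro z hz hFz
      by_contra hzV
      exact hUJ hFz ((hFJ' z).mpr (hfrJ z (by rw [hVo.frontier_eq]; exact ⟨hz, hzV⟩)))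
    have hopen : IsOpen (F '' V) := by
      rw [isOpen_iff_mem_nhds]
      rintro _ ⟨v1, hv1, rfl⟩
      by_contra hnot
      apply open_aux hd hN hF hFf hVo hgood hv1
      rw [mem_closure_iff]
      intro s hs hqs
      have : ¬ (s ∩ U ⊆ F '' V) := by
        intro hss
        exact hnot (mem_of_superset ((hs.inter hUo).mem_nhds ⟨hqs, hFV _ hv1⟩) hss)
      obtain ⟨z, hz, hzV⟩ := Set.not_subset.mp this
      have hzA : z ∉ F '' closure V := by
        rintro ⟨y, hy, rfl⟩
        exact hzV ⟨y, hAU y hy hz.2, rfl⟩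
      obtain ⟨_, hy, y, rfl⟩ := (dense_io hd).inter_open_nonempty (s ∩ (F '' closure V)ᶜ)
        (hs.inter hAc.isOpen_compl) ⟨z, hz.1, hzA⟩
      refine ⟨io hd y, hy.1, y, ?_, rfl⟩
      rintro w hw rfl
      exact hy.2 ⟨io hd w, subset_closure hw, hFf w⟩
    have hUV : U ⊆ F '' V := by
      apply (isPreconnected_connectedComponentIn (F := Jᶜ) (x := u)).subset_left_of_subset_union
        hopen hAc.isOpen_compl
      · exact Set.disjoint_compl_right_iff_subset.mpr (Set.image_mono subset_closure)
      · intro x hx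
        by_cases hxA : x ∈ F '' closure V
        · obtain ⟨y, hy, rfl⟩ := hxA
          exact Or.inl ⟨y, hAU y hy hx, rfl⟩
        · exact Or.inr hxA
      · exact ⟨F v, hvF, v, mem_connectedComponentIn hvJ, rfl⟩
    have hJA : ∀ j ∈ J, ∃ z ∈ frontier V, F z = j := by
      intro j hj
      have h1 : closure U ⊆ F '' closure V :=
        closure_minimal (hUV.trans (Set.image_mono subset_closure)) hAc
      obtain ⟨z, hz, rfl⟩ := h1 (by rw [hcl]; exact Or.inr hj)
      refine ⟨z, ?_, rfl⟩
      rw [hVo.frontier_eq]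
      exact ⟨hz, fun hzV => hUJ (hFV z hzV) hj⟩
    intro j hj k hk
    obtain ⟨z, hz, rfl⟩ := hJA j hj
    obtain ⟨z', hz', rfl⟩ := hJA k hk
    rw [hfrV hz hz']
  · have hFuJ : F u ∈ Jᶜ := fun h => hu ((hFJ' u).mp h)
    obtain ⟨-, hfrW⟩ := hcomp (F u) hFuJ hFu
    set W := connectedComponentIn Jᶜ (F u) with hW
    have hWo : IsOpen W := hJ.isOpen_compl.connectedComponentIn
    have hJW : ∀ j ∈ J, F j ∈ frontier W := by
      intro j hj
      rw [hWo.frontier_eq]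
      constructor
      · have h1 : F '' closure U ⊆ closure W :=
          (image_closure_subset_closure_image hF).trans (closure_mono (hFcomp u hu))
        exact h1 ⟨j, by rw [hcl]; exact Or.inr hj, rfl⟩
      · intro h
        exact connectedComponentIn_subset _ _ h ((hFJ' j).mpr hj)
    intro j hj k hk
    obtain ⟨j', rfl⟩ := hsurj j
    obtain ⟨k', rfl⟩ := hsurj k
    exact hfrW (hJW _ ((hFJ' _).mp hj)) (hJW _ ((hFJ' _).mp hk))

end XS

section Concrete

/-- Norm of the homogeneous coordinates. -/
noncomputable def nrm (w : OnePoint K) : ℝ := max ‖(homCoord K w).1‖ ‖(homCoord K w).2‖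

/-- wedge -/
noncomputable def wdg (u v : OnePoint K) : K :=
  (homCoord K u).1 * (homCoord K v).2 - (homCoord K u).2 * (homCoord K v).1

variable {K}

theorem chordal_eq (u v : OnePoint K) : chordal K u v = ‖wdg K u v‖ / (nrm K u * nrm K v) := rfl

@[simp] theorem homCoord_infty : homCoord K OnePoint.infty = (1, 0) := rfl
@[simp] theorem homCoord_coe (a : K) : homCoord K (a : OnePoint K) = (a, 1) := rfl

theorem nrm_pos (w : OnePoint K) : 0 < nrm K w := by
  induction w using OnePoint.rec with
  | infty => simp [nrm]
  | coe a => simp [nrm]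

theorem ratio_aux {A B C a b c : ℝ} (ha : 0 < a) (hb : 0 < b) (hc : 0 < c)
    (h : A * c ≤ max (B * a) (C * b)) : A / (a * b) ≤ max (B / (c * b)) (C / (a * c)) := by
  rcases le_max_iff.mp h with h | h
  · apply le_max_of_le_left
    rw [div_le_div_iff₀ (by positivity) (by positivity)]
    nlinarith
  · apply le_max_of_le_right
    rw [div_le_div_iff₀ (by positivity) (by positivity)]
    nlinarith

theorem norm_sub_le_max' (a b : K) : ‖a - b‖ ≤ max ‖a‖ ‖b‖ := by
  rw [sub_eq_add_neg, ← norm_neg b]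
  exact IsUltrametricDist.norm_add_le_max _ _

theorem wdg_le (u v : OnePoint K) : ‖wdg K u v‖ ≤ nrm K u * nrm K v := by
  unfold wdg
  apply (norm_sub_le_max' _ _).trans
  rw [norm_mul, norm_mul]
  apply max_le
  · exact mul_le_mul (le_max_left _ _) (le_max_right _ _) (norm_nonneg _) (nrm_pos u).le
  · exact mul_le_mul (le_max_right _ _) (le_max_left _ _) (norm_nonneg _) (nrm_pos u).le

theorem wdg_ult (u w v : OnePoint K) :
    ‖wdg K u v‖ * nrm K w ≤ max (‖wdg K w v‖ * nrm K u) (‖wdg K u w‖ * nrm K v) := by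
  have h1 : ‖wdg K u v‖ * ‖(homCoord K w).1‖ ≤ max (‖wdg K w v‖ * nrm K u) (‖wdg K u w‖ * nrm K v) := by
    rw [← norm_mul, show wdg K u v * (homCoord K w).1 =
      wdg K w v * (homCoord K u).1 + wdg K u w * (homCoord K v).1 by unfold wdg; ring]
    apply (IsUltrametricDist.norm_add_le_max _ _).trans
    rw [norm_mul, norm_mul]
    exact max_le_max (mul_le_mul_of_nonneg_left (le_max_left _ _) (norm_nonneg _))
      (mul_le_mul_of_nonneg_left (le_max_left _ _) (norm_nonneg _))
  have h2 : ‖wdg K u v‖ * ‖(homCoord K w).2‖ ≤ max (‖wdg K w v‖ * nrm K u) (‖wdg K u w‖ * nrm K v) := by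
    rw [← norm_mul, show wdg K u v * (homCoord K w).2 =
      wdg K w v * (homCoord K u).2 + wdg K u w * (homCoord K v).2 by unfold wdg; ring]
    apply (IsUltrametricDist.norm_add_le_max _ _).trans
    rw [norm_mul, norm_mul]
    exact max_le_max (mul_le_mul_of_nonneg_left (le_max_right _ _) (norm_nonneg _))
      (mul_le_mul_of_nonneg_left (le_max_right _ _) (norm_nonneg _))
  unfold nrm at *
  rcases le_total ‖(homCoord K w).1‖ ‖(homCoord K w).2‖ with h | h
  · rw [max_eq_right h]; exact h2
  · rw [max_eq_left h]; exact h1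

theorem exists_norm_between {α β : ℝ} (h0 : 0 ≤ α) (h : α < β) (h1 : β ≤ 1) :
    ∃ s : K, α < ‖s‖ ∧ ‖s‖ < β := by
  obtain ⟨α', hα, hαβ⟩ := exists_between h
  have hα0 : 0 < α' := h0.trans_lt hα
  have hβ : 0 < β := hα0.trans hαβ
  obtain ⟨π, hπ0, hπ1⟩ := NormedField.exists_norm_lt_one K
  have hr : α' / β < 1 := (div_lt_one hβ).mpr hαβ
  obtain ⟨n, hn⟩ := exists_pow_lt_of_lt_one hπ0 hr
  have hn0 : n ≠ 0 := by
    rintro rfl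
    simp at hn
    linarith
  obtain ⟨τ, hτ⟩ := IsAlgClosed.exists_pow_nat_eq π (Nat.pos_of_ne_zero hn0)
  have hτn : ‖τ‖ ^ n = ‖π‖ := by rw [← norm_pow, hτ]
  have hτ1 : ‖τ‖ < 1 := by
    by_contra! hc
    have := one_le_pow₀ hc (n := n)
    linarith
  have hτ2 : α' / β < ‖τ‖ := by
    by_contra! hc
    have := pow_le_pow_left₀ (norm_nonneg τ) hc n
    linarith
  have hτ0 : 0 < ‖τ‖ := lt_of_le_of_lt (by positivity) hτ2
  obtain ⟨m, hm1, hm2⟩ := exists_nat_pow_near_of_lt_one hβ h1 hτ0 hτ1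
  refine ⟨τ ^ (m + 1), ?_, by rwa [norm_pow]⟩
  rw [norm_pow, pow_succ]
  rw [div_lt_iff₀ hβ] at hτ2
  nlinarith

theorem chordal_dense (a : OnePoint K) {α β : ℝ} (h0 : 0 ≤ α) (h : α < β) (h1 : β ≤ 1) :
    ∃ c, α < chordal K a c ∧ chordal K a c < β := by
  obtain ⟨s, hs1, hs2⟩ := exists_norm_between (K := K) h0 h h1
  have hs0 : 0 < ‖s‖ := h0.trans_lt hs1
  have hs0' : s ≠ 0 := norm_pos_iff.mp hs0
  have hs3 : ‖s‖ < 1 := hs2.trans_le h1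
  suffices ∃ c, chordal K a c = ‖s‖ by
    obtain ⟨c, hc⟩ := this
    exact ⟨c, by rw [hc]; exact hs1, by rw [hc]; exact hs2⟩
  induction a using OnePoint.rec with
  | infty =>
    refine ⟨((s⁻¹ : K) : OnePoint K), ?_⟩
    have : 1 ≤ ‖s‖⁻¹ := (one_le_inv₀ hs0).mpr hs3.le
    simp [chordal, max_eq_left this]
  | coe a =>
    by_cases ha : ‖a‖ ≤ 1
    · refine ⟨((a + s : K) : OnePoint K), ?_⟩
      have : ‖a + s‖ ≤ 1 := (IsUltrametricDist.norm_add_le_max _ _).trans (max_le ha hs3.le)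
      simp [chordal, max_eq_right this, max_eq_right ha]
    · push Not at ha
      have ha0 : a ≠ 0 := norm_pos_iff.mp (one_pos.trans ha)
      by_cases hz : a⁻¹ + s = 0
      · refine ⟨OnePoint.infty, ?_⟩
        have : s = - a⁻¹ := by linear_combination hz
        simp [chordal, this, max_eq_left ha.le]
      · refine ⟨(((a⁻¹ + s)⁻¹ : K) : OnePoint K), ?_⟩
        have h3 : ‖a⁻¹ + s‖ ≤ 1 := (IsUltrametricDist.norm_add_le_max _ _).trans
          (max_le (by rw [norm_inv]; exact inv_le_one_of_one_le₀ ha.le) hs3.le)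
        have h4 : 1 ≤ ‖(a⁻¹ + s)⁻¹‖ := by
          rw [norm_inv]; exact (one_le_inv₀ (norm_pos_iff.mpr hz)).mpr h3
        have h5 : a * 1 - 1 * (a⁻¹ + s)⁻¹ = s * (a * (a⁻¹ + s)⁻¹) := by
          obtain ⟨e, he⟩ : ∃ e, e = a⁻¹ + s := ⟨_, rfl⟩
          rw [← he] at hz ⊢
          have hs' : s = e - a⁻¹ := by rw [he]; ring
          rw [hs']
          field_simp
        simp only [chordal, homCoord_coe, norm_one, max_eq_left h4, max_eq_left ha.le]
        rw [h5, norm_mul, norm_mul]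
        have : 0 < ‖a‖ * ‖(a⁻¹ + s)⁻¹‖ :=
          mul_pos (one_pos.trans ha) (one_pos.trans_le h4)
        rw [mul_div_assoc, div_self this.ne', mul_one]

theorem um_chordal : UM (chordal K) where
  self a := by simp [chordal, mul_comm]
  eq a b h := by
    rw [chordal_eq, div_eq_zero_iff, norm_eq_zero] at h
    have h := h.resolve_right (mul_pos (nrm_pos a) (nrm_pos b)).ne'
    induction a using OnePoint.rec with
    | infty =>
      induction b using OnePoint.rec with
      | infty => rfl
      | coe b => simp [wdg] at h
    | coe a =>
      induction b using OnePoint.rec with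
      | infty => simp [wdg] at h
      | coe b =>
        simp [wdg] at h
        rw [sub_eq_zero.mp h]
  symm a b := by
    rw [chordal_eq, chordal_eq, mul_comm (nrm K a)]
    congr 1
    rw [← norm_neg]
    congr 1
    unfold wdg
    ring
  nonneg a b := by
    rw [chordal_eq]
    exact div_nonneg (norm_nonneg _) (mul_pos (nrm_pos a) (nrm_pos b)).le
  le1 a b := by
    rw [chordal_eq]
    exact div_le_one_of_le₀ (wdg_le a b) (mul_pos (nrm_pos a) (nrm_pos b)).le
  ult a b c := by
    rw [chordal_eq, chordal_eq, chordal_eq, max_comm]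
    exact ratio_aux (nrm_pos a) (nrm_pos c) (nrm_pos b) (wdg_ult a b c)
  dense a α β h0 h h1 := chordal_dense a h0 h h1

/-- homogeneous evaluation -/
noncomputable def hev (n : ℕ) (p : K[X]) : OnePoint K → K :=
  OnePoint.rec (p.coeff n) (fun a => p.eval a)

@[simp] theorem hev_infty (n : ℕ) (p : K[X]) : hev n p OnePoint.infty = p.coeff n := rfl
@[simp] theorem hev_coe (n : ℕ) (p : K[X]) (a : K) : hev n p (a : OnePoint K) = p.eval a := rfl

theorem hev_fac (n : ℕ) (g : K[X]) (hg : g ≠ 0) (hn : g.natDegree ≤ n) :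
    ∃ c > 0, ∃ x : Fin n → OnePoint K, ∀ w,
      ‖hev n g w‖ / nrm K w ^ n = c * ∏ i, chordal K w (x i) := by
  induction n generalizing g with
  | zero =>
    have := natDegree_eq_zero.mp (Nat.le_zero.mp hn)
    obtain ⟨c, rfl⟩ := this
    refine ⟨‖c‖, norm_pos_iff.mpr (by rintro rfl; simp at hg), Fin.elim0, ?_⟩
    intro w
    induction w using OnePoint.rec with
    | infty => simp
    | coe a => simp
  | succ n ih =>
    rcases Nat.lt_or_ge n g.natDegree with hlt | hle
    · have hdeg : g.natDegree = n + 1 := le_antisymm hn hlt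
      obtain ⟨r, hr⟩ := IsAlgClosed.exists_root g (by
        rw [degree_eq_natDegree hg, hdeg]; exact_mod_cast Nat.succ_ne_zero n)
      obtain ⟨g', rfl⟩ := dvd_iff_isRoot.mpr hr
      have hg' : g' ≠ 0 := right_ne_zero_of_mul hg
      have hd' : g'.natDegree = n := by
        rw [natDegree_mul (X_sub_C_ne_zero r) hg', natDegree_X_sub_C] at hdeg
        omega
      obtain ⟨c, hc, x, hx⟩ := ih g' hg' hd'.le
      refine ⟨c * nrm K (r : OnePoint K), mul_pos hc (nrm_pos _), Fin.cons (r : OnePoint K) x, ?_⟩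
      intro w
      rw [Fin.prod_univ_succ]
      simp only [Fin.cons_zero, Fin.cons_succ]
      have key : ‖hev (n + 1) ((X - C r) * g') w‖ = ‖wdg K w r‖ * ‖hev n g' w‖ := by
        rw [← norm_mul]
        congr 1
        induction w using OnePoint.rec with
        | infty =>
          have : ((X - C r) * g').coeff (n + 1) = g'.coeff n := by
            rw [sub_mul, coeff_sub, coeff_X_mul, coeff_C_mul,
              coeff_eq_zero_of_natDegree_lt (by omega : g'.natDegree < n + 1)]
            ring
          simp [wdg, this]
        | coe a => simp [wdg]
      rw [key, pow_succ]
      have h1 := hx w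
      have h2 := (nrm_pos w).ne'
      have h3 := (nrm_pos (r : OnePoint K)).ne'
      rw [chordal_eq]
      calc _ = (‖hev n g' w‖ / nrm K w ^ n) * (‖wdg K w r‖ / nrm K w) := by
            field_simp
        _ = _ := by rw [h1]; field_simp
    · obtain ⟨c, hc, x, hx⟩ := ih g hg hle
      refine ⟨c, hc, Fin.cons OnePoint.infty x, ?_⟩
      intro w
      rw [Fin.prod_univ_succ]
      simp only [Fin.cons_zero, Fin.cons_succ]
      have key : ‖hev (n + 1) g w‖ = ‖wdg K w OnePoint.infty‖ * ‖hev n g w‖ := by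
        induction w using OnePoint.rec with
        | infty => simp [wdg, coeff_eq_zero_of_natDegree_lt (by omega : g.natDegree < n + 1)]
        | coe a => simp [wdg]
      have hni : nrm K OnePoint.infty = 1 := by simp [nrm]
      rw [chordal_eq, hni, mul_one, pow_succ]
      have h1 := hx w
      have h2 := (nrm_pos w).ne'
      calc _ = (‖hev n g w‖ / nrm K w ^ n) * (‖wdg K w OnePoint.infty‖ / nrm K w) := by
            rw [key]; field_simp
        _ = _ := by rw [h1]; ring

theorem hev_ne (f : RatFunc K) (w : OnePoint K) :
    hev (rdeg K f) f.num w ≠ 0 ∨ hev (rdeg K f) f.denom w ≠ 0 := by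
  induction w using OnePoint.rec with
  | infty =>
    simp only [hev_infty, rdeg]
    rcases Nat.lt_or_ge f.denom.natDegree f.num.natDegree with h | h
    · left
      rw [max_eq_left h.le]
      rw [coeff_natDegree, leadingCoeff_ne_zero]
      rintro e
      rw [e] at h
      simp at h
    · right
      rw [max_eq_right h, coeff_natDegree, leadingCoeff_ne_zero]
      exact f.denom_ne_zero
  | coe a =>
    simp only [hev_coe]
    obtain ⟨u, v, huv⟩ := RatFunc.isCoprime_num_denom f
    by_contra! hc
    have := congrArg (Polynomial.eval a) huv
    simp [hc.1, hc.2] at this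

theorem evalP1_eq (f : RatFunc K) (w : OnePoint K) :
    evalP1 K f w = if hev (rdeg K f) f.denom w = 0 then OnePoint.infty else
      ((hev (rdeg K f) f.num w / hev (rdeg K f) f.denom w : K) : OnePoint K) := by
  induction w using OnePoint.rec with
  | infty =>
    change (if f.denom.natDegree < f.num.natDegree then OnePoint.infty
      else ((f.num.coeff f.denom.natDegree / f.denom.leadingCoeff : K) : OnePoint K)) = _
    rcases Nat.lt_or_ge f.denom.natDegree f.num.natDegree with h | h
    · have hB : hev (rdeg K f) f.denom OnePoint.infty = 0 := by
        rw [hev_infty, rdeg, max_eq_left h.le]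
        exact coeff_eq_zero_of_natDegree_lt h
      rw [if_pos h, if_pos hB]
    · have hr : rdeg K f = f.denom.natDegree := max_eq_right h
      have hB : hev (rdeg K f) f.denom OnePoint.infty ≠ 0 := by
        rw [hev_infty, hr, coeff_natDegree, Ne, leadingCoeff_eq_zero]
        exact f.denom_ne_zero
      rw [if_neg (not_lt.mpr h), if_neg hB, hev_infty, hev_infty, hr, coeff_natDegree]
  | coe a => rfl

theorem fac_evalP1 (f : RatFunc K) (hn : 0 < rdeg K f) :
    XS.Fac (chordal K) (evalP1 K f) (rdeg K f)
      (fun w => max ‖hev (rdeg K f) f.num w‖ ‖hev (rdeg K f) f.denom w‖ / nrm K w ^ rdeg K f) where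
  npos w := by
    apply div_pos _ (pow_pos (nrm_pos w) _)
    rcases hev_ne f w with h | h
    · exact lt_max_of_lt_left (norm_pos_iff.mpr h)
    · exact lt_max_of_lt_right (norm_pos_iff.mpr h)
  fac y := by
    set n := rdeg K f with hndef
    set g := C (homCoord K y).2 * f.num - C (homCoord K y).1 * f.denom with hg
    have hgd : g.natDegree ≤ n := by
      apply (natDegree_sub_le _ _).trans
      apply max_le
      · exact (natDegree_C_mul_le _ _).trans (le_max_left _ _)
      · exact (natDegree_C_mul_le _ _).trans (le_max_right _ _)
    have hg0 : g ≠ 0 := by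
      intro h0
      induction y using OnePoint.rec with
      | infty =>
        simp [hg, f.denom_ne_zero] at h0
      | coe y =>
        simp only [hg, homCoord_coe, map_one, one_mul, sub_eq_zero] at h0
        have hu : IsUnit f.denom := by
          apply (RatFunc.isCoprime_num_denom f).isUnit_of_dvd'
          · rw [h0]; exact dvd_mul_left _ _
          · exact dvd_rfl
        have h1 := natDegree_eq_zero_of_isUnit hu
        have h2 : f.num.natDegree ≤ f.denom.natDegree := by
          rw [h0]; exact natDegree_C_mul_le _ _
        have : n = 0 := by
          rw [hndef, rdeg]; omega
        omega
    obtain ⟨c, hc, x, hx⟩ := hev_fac n g hg0 hgd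
    refine ⟨c / nrm K y, div_pos hc (nrm_pos y), x, ?_⟩
    intro w
    have hlin : hev n g w = (homCoord K y).2 * hev n f.num w - (homCoord K y).1 * hev n f.denom w := by
      induction w using OnePoint.rec with
      | infty => simp [hg]
      | coe a => simp [hg]
    have key : chordal K (evalP1 K f w) y * max ‖hev n f.num w‖ ‖hev n f.denom w‖ =
        ‖hev n g w‖ / nrm K y := by
      have hne := hev_ne f w
      rw [← hndef] at hne
      rw [evalP1_eq, ← hndef, chordal_eq, hlin]
      generalize hev n f.num w = A at *
      generalize hev n f.denom w = B at *
      have hy := (nrm_pos y).ne'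
      by_cases hB : B = 0
      · subst hB
        have hA : ‖A‖ ≠ 0 := norm_ne_zero_iff.mpr (hne.resolve_right (by simp))
        simp only [if_true, wdg, homCoord_infty, norm_zero, max_eq_left (norm_nonneg A)]
        have : nrm K OnePoint.infty = 1 := by simp [nrm]
        rw [this]
        simp
        field_simp
      · simp only [hB, if_false]
        have hB' : 0 < ‖B‖ := norm_pos_iff.mpr hB
        have h1 : nrm K ((A / B : K) : OnePoint K) * ‖B‖ = max ‖A‖ ‖B‖ := by
          simp only [nrm, homCoord_coe, norm_div, norm_one]
          rw [max_mul_of_nonneg _ _ hB'.le, one_mul]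
          congr 1
          field_simp
        have h2 : ‖wdg K ((A / B : K) : OnePoint K) y‖ * ‖B‖ =
            ‖(homCoord K y).2 * A - (homCoord K y).1 * B‖ := by
          rw [← norm_mul]
          congr 1
          simp only [wdg, homCoord_coe]
          field_simp
          try ring
        rw [← h1, ← h2]
        have := (nrm_pos ((A / B : K) : OnePoint K)).ne'
        field_simp
    have h1 := hx w
    calc _ = (chordal K (evalP1 K f w) y * max ‖hev n f.num w‖ ‖hev n f.denom w‖) / nrm K w ^ n := by ring
      _ = (‖hev n g w‖ / nrm K w ^ n) / nrm K y := by rw [key]; ring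
      _ = _ := by rw [h1]; ring

theorem ba_zero (x : BerkA1 K) : x.toFun 0 = 0 := by
  rw [← C_0, x.restricts', norm_zero]

theorem ba_one (x : BerkA1 K) : x.toFun 1 = 1 := by
  rw [← C_1, x.restricts', norm_one]

theorem ba_neg (x : BerkA1 K) (p : K[X]) : x.toFun (-p) = x.toFun p := by
  have : -p = C (-1) * p := by simp
  rw [this, x.map_mul', x.restricts']
  simp

theorem ba_pow (x : BerkA1 K) (p : K[X]) (n : ℕ) : x.toFun (p ^ n) = x.toFun p ^ n := by
  induction n with
  | zero => simp [ba_one]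
  | succ n ih => rw [pow_succ, x.map_mul', ih, pow_succ]

theorem ba_sum_le (x : BerkA1 K) {ι : Type*} (s : Finset ι) (g : ι → K[X]) :
    x.toFun (∑ i ∈ s, g i) ≤ ∑ i ∈ s, x.toFun (g i) := by
  induction s using Finset.induction_on with
  | empty => simp [ba_zero]
  | insert a s ha ih =>
    rw [Finset.sum_insert ha, Finset.sum_insert ha]
    exact (x.add_le' _ _).trans (by linarith)

theorem ba_ult (x : BerkA1 K) (p q : K[X]) : x.toFun (p + q) ≤ max (x.toFun p) (x.toFun q) := by
  set m := max (x.toFun p) (x.toFun q) with hm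
  have hm0 : 0 ≤ m := le_max_of_le_left (x.nonneg' p)
  have key : ∀ n : ℕ, x.toFun (p + q) ^ n ≤ (n + 1) * m ^ n := by
    intro n
    rw [← ba_pow, add_pow]
    apply (ba_sum_le x _ _).trans
    have : ∀ i ∈ Finset.range (n + 1),
        x.toFun (p ^ i * q ^ (n - i) * ((n.choose i : ℕ) : K[X])) ≤ m ^ n := by
      intro i hi
      have hin : i + (n - i) = n := by
        have := Finset.mem_range.mp hi
        omega
      rw [x.map_mul', x.map_mul', ba_pow, ba_pow]
      have h1 : x.toFun ((n.choose i : ℕ) : K[X]) ≤ 1 := by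
        rw [← C_eq_natCast, x.restricts']
        exact IsUltrametricDist.norm_natCast_le_one K _
      have h2 : x.toFun p ^ i * x.toFun q ^ (n - i) ≤ m ^ n := by
        calc _ ≤ m ^ i * m ^ (n - i) :=
              mul_le_mul (pow_le_pow_left₀ (x.nonneg' p) (le_max_left _ _) _)
                (pow_le_pow_left₀ (x.nonneg' q) (le_max_right _ _) _)
                (pow_nonneg (x.nonneg' q) _) (pow_nonneg hm0 _)
          _ = m ^ n := by rw [← pow_add, hin]
      calc _ ≤ m ^ n * 1 := mul_le_mul h2 h1 (x.nonneg' _) (pow_nonneg hm0 _)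
        _ = m ^ n := mul_one _
    apply (Finset.sum_le_sum this).trans
    simp
  by_contra! hc
  rcases hm0.eq_or_lt with h0 | h0
  · have := key 1
    rw [← h0] at this hc
    simp at this
    linarith
  · have hr : 1 < x.toFun (p + q) / m := (one_lt_div h0).mpr hc
    have hr0 : 0 < x.toFun (p + q) / m := one_pos.trans hr
    have t1 := tendsto_pow_const_div_const_pow_of_one_lt 1 hr
    have t0 := tendsto_pow_const_div_const_pow_of_one_lt 0 hr
    have t := t1.add t0
    have := (t.eventually_lt_const (by norm_num : (0 : ℝ) + 0 < 1)).exists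
    obtain ⟨n, hn⟩ := this
    have hk := key n
    rw [pow_one, pow_zero, ← add_div, div_lt_one (pow_pos hr0 n), div_pow,
      lt_div_iff₀ (pow_pos h0 n)] at hn
    linarith

theorem ba_sub (x : BerkA1 K) (p q : K[X]) : x.toFun (p - q) ≤ max (x.toFun p) (x.toFun q) := by
  rw [sub_eq_add_neg, ← ba_neg x q]
  exact ba_ult x _ _

theorem ba_ext {x y : BerkA1 K} (h : ∀ p, x.toFun p = y.toFun p) : x = y := by
  cases x
  cases y
  congr
  exact funext h

/-- linear form attached to a point -/
noncomputable def lin (w : OnePoint K) : K[X] := C (homCoord K w).2 * X - C (homCoord K w).1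

/-- normalising factor -/
noncomputable def bm (x : BerkA1 K) : ℝ := max 1 (x.toFun X)

theorem bm_pos (x : BerkA1 K) : 0 < bm x := one_pos.trans_le (le_max_left _ _)

theorem lin_infty : lin (OnePoint.infty : OnePoint K) = -1 := by simp [lin]

theorem lin_coe (a : K) : lin (a : OnePoint K) = X - C a := by simp [lin]

theorem lin_le (x : BerkA1 K) (w : OnePoint K) : x.toFun (lin w) ≤ nrm K w * bm x := by
  unfold lin
  apply (ba_sub x _ _).trans
  rw [x.map_mul', x.restricts', x.restricts']
  apply max_le
  · exact mul_le_mul (le_max_right _ _) (le_max_right _ _) (x.nonneg' _) (nrm_pos w).le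
  · calc _ = ‖(homCoord K w).1‖ * 1 := (mul_one _).symm
      _ ≤ _ := mul_le_mul (le_max_left _ _) (le_max_left _ _) zero_le_one (nrm_pos w).le

theorem lin_u1 (x : BerkA1 K) (a b : OnePoint K) :
    x.toFun (lin a) * nrm K b ≤ max (x.toFun (lin b) * nrm K a) (‖wdg K a b‖ * bm x) := by
  have h2 : x.toFun (lin a) * ‖(homCoord K b).2‖ ≤
      max (x.toFun (lin b) * nrm K a) (‖wdg K a b‖ * bm x) := by
    rw [← x.restricts', ← x.map_mul', show lin a * C (homCoord K b).2 =
      lin b * C (homCoord K a).2 - C (wdg K a b) * 1 by simp [lin, wdg]; ring]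
    apply (ba_sub x _ _).trans
    rw [x.map_mul', x.map_mul', x.restricts', x.restricts', ba_one]
    exact max_le_max (mul_le_mul_of_nonneg_left (le_max_right _ _) (x.nonneg' _))
      (mul_le_mul_of_nonneg_left (le_max_left _ _) (norm_nonneg _))
  have h1 : x.toFun (lin a) * ‖(homCoord K b).1‖ ≤
      max (x.toFun (lin b) * nrm K a) (‖wdg K a b‖ * bm x) := by
    rw [← x.restricts', ← x.map_mul', show lin a * C (homCoord K b).1 =
      lin b * C (homCoord K a).1 - C (wdg K a b) * X by simp [lin, wdg]; ring]
    apply (ba_sub x _ _).trans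
    rw [x.map_mul', x.map_mul', x.restricts', x.restricts']
    exact max_le_max (mul_le_mul_of_nonneg_left (le_max_left _ _) (x.nonneg' _))
      (mul_le_mul_of_nonneg_left (le_max_right _ _) (norm_nonneg _))
  rw [show nrm K b = max ‖(homCoord K b).1‖ ‖(homCoord K b).2‖ from rfl]
  rcases le_total ‖(homCoord K b).1‖ ‖(homCoord K b).2‖ with h | h
  · rw [max_eq_right h]; exact h2
  · rw [max_eq_left h]; exact h1

theorem lin_u2 (x : BerkA1 K) (a b : OnePoint K) :
    ‖wdg K a b‖ * bm x ≤ max (x.toFun (lin b) * nrm K a) (x.toFun (lin a) * nrm K b) := by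
  have h2 : ‖wdg K a b‖ * 1 ≤
      max (x.toFun (lin b) * nrm K a) (x.toFun (lin a) * nrm K b) := by
    rw [← x.restricts', ← ba_one x, ← x.map_mul', show C (wdg K a b) * 1 =
      lin b * C (homCoord K a).2 - lin a * C (homCoord K b).2 by simp [lin, wdg]; ring]
    apply (ba_sub x _ _).trans
    rw [x.map_mul', x.map_mul', x.restricts', x.restricts']
    exact max_le_max (mul_le_mul_of_nonneg_left (le_max_right _ _) (x.nonneg' _))
      (mul_le_mul_of_nonneg_left (le_max_right _ _) (x.nonneg' _))
  have h1 : ‖wdg K a b‖ * x.toFun X ≤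
      max (x.toFun (lin b) * nrm K a) (x.toFun (lin a) * nrm K b) := by
    rw [← x.restricts', ← x.map_mul', show C (wdg K a b) * X =
      lin b * C (homCoord K a).1 - lin a * C (homCoord K b).1 by simp [lin, wdg]; ring]
    apply (ba_sub x _ _).trans
    rw [x.map_mul', x.map_mul', x.restricts', x.restricts']
    exact max_le_max (mul_le_mul_of_nonneg_left (le_max_left _ _) (x.nonneg' _))
      (mul_le_mul_of_nonneg_left (le_max_left _ _) (x.nonneg' _))
  unfold bm
  rcases le_total 1 (x.toFun X) with h | h
  · rw [max_eq_right h]; exact h1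
  · rw [max_eq_left h]; exact h2

/-- the affine part of the comparison map -/
noncomputable def kapA (x : BerkA1 K) : XS (chordal K) :=
  ⟨fun w => x.toFun (lin w) / (nrm K w * bm x), fun w =>
    ⟨div_nonneg (x.nonneg' _) (mul_pos (nrm_pos w) (bm_pos x)).le,
      div_le_one_of_le₀ (lin_le x w) (mul_pos (nrm_pos w) (bm_pos x)).le⟩,
    fun a b => ratio_aux (nrm_pos a) (bm_pos x) (nrm_pos b) (lin_u1 x a b),
    fun a b => by
      rw [chordal_eq]
      have := ratio_aux (nrm_pos a) (nrm_pos b) (bm_pos x) (lin_u2 x a b)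
      rwa [max_comm, mul_comm (bm x)] at this⟩

theorem kapA_apply (x : BerkA1 K) (w : OnePoint K) :
    kapA x w = x.toFun (lin w) / (nrm K w * bm x) := rfl

theorem nrm_infty : nrm K OnePoint.infty = 1 := by simp [nrm]

theorem kapA_infty (x : BerkA1 K) : kapA x OnePoint.infty = (bm x)⁻¹ := by
  rw [kapA_apply, lin_infty, ba_neg, ba_one, nrm_infty, one_mul, one_div]

/-- the comparison map -/
noncomputable def kap : BerkP1 K → XS (chordal K) :=
  OnePoint.rec (XS.io um_chordal OnePoint.infty) kapA

theorem kap_infty : kap (OnePoint.infty : BerkP1 K) = XS.io um_chordal OnePoint.infty := rfl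
theorem kap_coe (x : BerkA1 K) : kap (x : BerkP1 K) = kapA x := rfl

theorem ba_cont (p : K[X]) : Continuous (fun x : BerkA1 K => x.toFun p) :=
  (continuous_apply p).comp continuous_induced_dom

theorem kapA_cont : Continuous (kapA : BerkA1 K → XS (chordal K)) := by
  apply Continuous.subtype_mk
  apply continuous_pi
  intro w
  apply Continuous.div (ba_cont _)
  · exact continuous_const.mul (continuous_const.max (ba_cont _))
  · intro x
    exact (mul_pos (nrm_pos w) (bm_pos x)).ne'

theorem ba_le (x : BerkA1 K) {R : ℝ} (h : x.toFun X ≤ R) (p : K[X]) :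
    x.toFun p ≤ ∑ i ∈ Finset.range (p.natDegree + 1), ‖p.coeff i‖ * R ^ i := by
  conv_lhs => rw [p.as_sum_range_C_mul_X_pow]
  apply (ba_sum_le x _ _).trans
  apply Finset.sum_le_sum
  intro i _
  rw [x.map_mul', x.restricts', ba_pow]
  exact mul_le_mul_of_nonneg_left (pow_le_pow_left₀ (x.nonneg' _) h _) (norm_nonneg _)

theorem ba_closed (R : ℝ) : IsClosed {x : BerkA1 K | x.toFun X ≤ R} :=
  isClosed_le (ba_cont _) continuous_const

theorem ba_compact (R : ℝ) : IsCompact {x : BerkA1 K | x.toFun X ≤ R} := by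
  have hi : Topology.IsInducing (BerkA1.toFun : BerkA1 K → K[X] → ℝ) := ⟨rfl⟩
  rw [hi.isCompact_iff]
  have hr : (BerkA1.toFun '' {x : BerkA1 K | x.toFun X ≤ R}) = {φ : K[X] → ℝ |
      (∀ p, 0 ≤ φ p) ∧ (∀ p q, φ (p * q) = φ p * φ q) ∧ (∀ p q, φ (p + q) ≤ φ p + φ q) ∧
      (∀ c : K, φ (C c) = ‖c‖) ∧ φ X ≤ R} := by
    ext φ
    constructor
    · rintro ⟨x, hx, rfl⟩
      exact ⟨x.nonneg', x.map_mul', x.add_le', x.restricts', hx⟩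
    · rintro ⟨h1, h2, h3, h4, h5⟩
      exact ⟨⟨φ, h1, h2, h3, h4⟩, h5, rfl⟩
  have hsub : (BerkA1.toFun '' {x : BerkA1 K | x.toFun X ≤ R}) ⊆ Set.pi Set.univ
      (fun p : K[X] => Set.Icc (0 : ℝ)
        (∑ i ∈ Finset.range (p.natDegree + 1), ‖p.coeff i‖ * R ^ i)) := by
    rintro _ ⟨x, hx, rfl⟩ p _
    exact ⟨x.nonneg' p, ba_le x hx p⟩
  refine IsCompact.of_isClosed_subset (isCompact_univ_pi (fun p => isCompact_Icc)) ?_ hsub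
  rw [hr]
  simp only [Set.ofPred_and, Set.ofPred_forall]
  refine IsClosed.inter ?_ (IsClosed.inter ?_ (IsClosed.inter ?_ (IsClosed.inter ?_ ?_)))
  · exact isClosed_iInter fun p => isClosed_le continuous_const (continuous_apply p)
  · exact isClosed_iInter fun p => isClosed_iInter fun q =>
      isClosed_eq (continuous_apply _) ((continuous_apply p).mul (continuous_apply q))
  · exact isClosed_iInter fun p => isClosed_iInter fun q =>
      isClosed_le (continuous_apply _) ((continuous_apply p).add (continuous_apply q))
  · exact isClosed_iInter fun c => isClosed_eq (continuous_apply _) continuous_const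
  · exact isClosed_le (continuous_apply _) continuous_const

theorem kap_cont : Continuous (kap : BerkP1 K → XS (chordal K)) := by
  rw [OnePoint.continuous_iff]
  refine ⟨?_, kapA_cont⟩
  have hlarge : ∀ R : ℝ, ∀ᶠ x in coclosedCompact (BerkA1 K), R < x.toFun X := by
    intro R
    have := (ba_compact (K := K) R).compl_mem_coclosedCompact_of_isClosed (ba_closed R)
    filter_upwards [this] with x hx
    exact not_le.mp hx
  rw [XS.val_inducing.tendsto_nhds_iff, tendsto_pi_nhds]
  intro w
  change Tendsto (fun x : BerkA1 K => kapA x w) _ (𝓝 (chordal K OnePoint.infty w))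
  induction w using OnePoint.rec with
  | infty =>
    rw [um_chordal.self]
    have : Tendsto (fun x : BerkA1 K => bm x) (coclosedCompact (BerkA1 K)) atTop := by
      rw [tendsto_atTop]
      intro R
      filter_upwards [hlarge R] with x hx
      exact hx.le.trans (le_max_right _ _)
    simp only [kapA_infty]
    exact tendsto_inv_atTop_zero.comp this
  | coe a =>
    apply tendsto_const_nhds.congr'
    filter_upwards [hlarge (max 1 ‖a‖)] with x hx
    have h1 : 1 < x.toFun X := (le_max_left _ _).trans_lt hx
    have h2 : ‖a‖ < x.toFun X := (le_max_right _ _).trans_lt hx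
    have h3 : x.toFun (X - C a) = x.toFun X := by
      apply le_antisymm
      · apply (ba_sub x _ _).trans
        rw [x.restricts', max_eq_left h2.le]
      · have := ba_ult x (X - C a) (C a)
        rw [sub_add_cancel, x.restricts'] at this
        rcases le_max_iff.mp this with h | h
        · exact h
        · linarith
    rw [kapA_apply, lin_coe, h3, bm, max_eq_right h1.le, chordal_eq, nrm_infty]
    have h4 := (nrm_pos (a : OnePoint K)).ne'
    have h5 : x.toFun X ≠ 0 := by linarith
    simp [wdg]
    field_simp

theorem kap_inj : Function.Injective (kap : BerkP1 K → XS (chordal K)) := by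
  have hne : ∀ x : BerkA1 K, kapA x ≠ XS.io um_chordal OnePoint.infty := by
    intro x h
    have := congrArg (fun y : XS (chordal K) => y OnePoint.infty) h
    simp only [kapA_infty, XS.io_apply, um_chordal.self] at this
    exact (inv_pos.mpr (bm_pos x)).ne' this
  intro x y hxy
  induction x using OnePoint.rec with
  | infty =>
    induction y using OnePoint.rec with
    | infty => rfl
    | coe y => exact absurd hxy.symm (hne y)
  | coe x =>
    induction y using OnePoint.rec with
    | infty => exact absurd hxy (hne x)
    | coe y =>
      rw [kap_coe, kap_coe] at hxy
      congr 1
      have hbm : bm x = bm y := by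
        have := congrArg (fun y : XS (chordal K) => y OnePoint.infty) hxy
        simp only [kapA_infty] at this
        exact inv_injective this
      have hl : ∀ a : K, x.toFun (X - C a) = y.toFun (X - C a) := by
        intro a
        have := congrArg (fun y : XS (chordal K) => y (a : OnePoint K)) hxy
        simp only [kapA_apply, hbm, lin_coe] at this
        exact (div_left_inj' (mul_pos (nrm_pos _) (bm_pos y)).ne').mp this
      apply ba_ext
      have hdeg : ∀ n : ℕ, ∀ p : K[X], p.natDegree = n → x.toFun p = y.toFun p := by
        intro n
        induction n with
        | zero =>
          intro p hp
          obtain ⟨c, rfl⟩ := natDegree_eq_zero.mp hp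
          rw [x.restricts', y.restricts']
        | succ n ih =>
          intro p hp
          have hp0 : p ≠ 0 := by
            rintro rfl
            simp at hp
          obtain ⟨r, hr⟩ := IsAlgClosed.exists_root p (by
            rw [degree_eq_natDegree hp0, hp]; exact_mod_cast Nat.succ_ne_zero n)
          obtain ⟨g, rfl⟩ := dvd_iff_isRoot.mpr hr
          have hg' : g ≠ 0 := right_ne_zero_of_mul hp0
          rw [natDegree_mul (X_sub_C_ne_zero r) hg', natDegree_X_sub_C] at hp
          rw [x.map_mul', y.map_mul', hl, ih g (by omega)]
      exact fun p => hdeg _ p rfl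

theorem kap_iota (w : OnePoint K) : kap (iota K w) = XS.io um_chordal w := by
  induction w using OnePoint.rec with
  | infty => rfl
  | coe a =>
    apply XS.eq_io
    change kapA (evalSeminorm K a) (a : OnePoint K) = 0
    rw [kapA_apply, lin_coe]
    simp [evalSeminorm]

theorem kap_surj : Function.Surjective (kap : BerkP1 K → XS (chordal K)) := by
  have h1 : IsClosed (Set.range (kap : BerkP1 K → XS (chordal K))) :=
    (isCompact_range kap_cont).isClosed
  have h2 : Set.range (XS.io (um_chordal (K := K))) ⊆ Set.range (kap : BerkP1 K → XS (chordal K)) := by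
    rintro _ ⟨w, rfl⟩
    exact ⟨iota K w, kap_iota w⟩
  intro y
  exact closure_minimal h2 h1 (XS.dense_io um_chordal y)

/-- The comparison homeomorphism. -/
noncomputable def kapE : BerkP1 K ≃ₜ XS (chordal K) :=
  Continuous.homeoOfEquivCompactToT2 (f := Equiv.ofBijective kap ⟨kap_inj, kap_surj⟩) kap_cont

theorem kapE_apply (x : BerkP1 K) : kapE x = kap x := rfl

theorem msupport_closed (μ : Measure (BerkP1 K)) : IsClosed (msupport K μ) := by
  rw [← isOpen_compl_iff, isOpen_iff_forall_mem_open]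
  intro x hx
  simp only [Set.mem_compl_iff, msupport, Set.mem_ofPred_eq, not_forall] at hx
  obtain ⟨U, hU, hxU, hμ⟩ := hx
  refine ⟨U, ?_, hU, hxU⟩
  intro y hy hys
  exact hμ (hys U hU hy)

theorem msupport_compl_null (μ : Measure (BerkP1 K)) [μ.Regular] : μ (msupport K μ)ᶜ = 0 := by
  rw [(msupport_closed μ).isOpen_compl.measure_eq_iSup_isCompact]
  simp only [ENNReal.iSup_eq_zero]
  intro C hC hCc
  apply hCc.measure_zero_of_nhdsWithin
  intro x hx
  have hx := hC hx
  simp only [Set.mem_compl_iff, msupport, Set.mem_ofPred_eq, not_forall] at hx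
  obtain ⟨U, hU, hxU, hμ⟩ := hx
  exact ⟨U, mem_nhdsWithin_of_mem_nhds (hU.mem_nhds hxU), by simpa using hμ⟩

theorem final_aux (f : RatFunc K) (hd : 1 < rdeg K f)
    (F : BerkP1 K → BerkP1 K) (hFc : Continuous F)
    (hFext : ∀ w : OnePoint K, F (iota K w) = iota K (evalP1 K f w))
    (J : Set (BerkP1 K)) (hJ : IsClosed J) (hJn : J.Nonempty) (hsupp : F ⁻¹' J = J)
    (x : BerkP1 K) (hx : x ∈ Jᶜ)
    (hUinv : F ⁻¹' (connectedComponentIn Jᶜ x) ≠ connectedComponentIn Jᶜ x)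
    (hfr : frontier (connectedComponentIn Jᶜ x) = J) :
    ∃ S, J = {S} ∧ ∀ a : OnePoint K, iota K a ≠ S := by
  have hpre : ∀ A : Set (BerkP1 K), (fun y => kapE (F (kapE.symm y))) ⁻¹' (kapE '' A) =
      kapE '' (F ⁻¹' A) := by
    intro A
    ext y
    simp only [Set.mem_preimage, Set.mem_image]
    constructor
    · rintro ⟨z, hz, hzy⟩
      refine ⟨kapE.symm y, ?_, by simp⟩
      rw [← kapE.injective hzy]
      exact hz
    · rintro ⟨z, hz, rfl⟩
      exact ⟨F z, hz, by simp⟩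
  have hcc : kapE '' (connectedComponentIn Jᶜ x) =
      connectedComponentIn (kapE '' J)ᶜ (kapE x) := by
    rw [kapE.image_connectedComponentIn hx, Set.image_compl_eq kapE.bijective]
  obtain ⟨S, hS, hSa⟩ := XS.main_abs um_chordal (f := evalP1 K f) (n := rdeg K f)
    (zero_lt_one.trans hd) (fac_evalP1 f (zero_lt_one.trans hd))
    (F := fun y => kapE (F (kapE.symm y))) (by fun_prop)
    (by
      intro w
      have h1 : kapE.symm (XS.io um_chordal w) = iota K w := by
        rw [← kap_iota, ← kapE_apply, Homeomorph.symm_apply_apply]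
      change kapE (F (kapE.symm (XS.io um_chordal w))) = _
      rw [h1, hFext, kapE_apply, kap_iota])
    (J := kapE '' J) (kapE.isClosed_image.mpr hJ) (hJn.image _)
    (by rw [hpre, hsupp]) (u := kapE x)
    (by
      rw [← Set.image_compl_eq kapE.bijective]
      exact Set.mem_image_of_mem _ hx)
    (by
      rw [← hcc, hpre]
      intro h
      exact hUinv (kapE.injective.image_injective h))
    (by rw [← hcc, ← kapE.image_frontier, hfr])
  refine ⟨kapE.symm S, ?_, ?_⟩
  · apply kapE.injective.image_injective
    rw [hS]
    simp
  · intro a ha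
    apply hSa a
    rw [← kap_iota, ha, ← kapE_apply, Homeomorph.apply_symm_apply]

end Concrete

/-- If `μ` is a Radon probability measure whose support is totally invariant under (the
canonical continuous extension to `P^1_Berk(K)` of) a rational function `f` of degree `> 1`,
and `μ` has no atoms at non-classical points, then any connected component `U` of the
complement of `supp μ` with `f⁻¹(U) ≠ U` satisfies `∂U ≠ supp μ`. -/
theorem boundary_of_component_ne_support (f : RatFunc K) (hd : 1 < rdeg K f)
    (F : BerkP1 K → BerkP1 K) (hFc : Continuous F)
    (hFext : ∀ w : OnePoint K, F (iota K w) = iota K (evalP1 K f w))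
    (μ : Measure (BerkP1 K)) (hμp : IsProbabilityMeasure μ) (hμr : μ.Regular)
    (hsupp : F ⁻¹' msupport K μ = msupport K μ)
    (hatom : ∀ S : BerkP1 K, (∀ a : OnePoint K, iota K a ≠ S) → μ {S} = 0)
    (x : BerkP1 K) (hx : x ∈ (msupport K μ)ᶜ)
    (U : Set (BerkP1 K)) (hU : U = connectedComponentIn ((msupport K μ)ᶜ) x)
    (hUinv : F ⁻¹' U ≠ U) :
    frontier U ≠ msupport K μ := by
  intro hfr
  subst hU
  have hnull := msupport_compl_null μ
  have hne : (msupport K μ).Nonempty := by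
    by_contra hc
    rw [Set.not_nonempty_iff_eq_empty] at hc
    rw [hc, Set.compl_empty, measure_univ] at hnull
    exact one_ne_zero hnull
  obtain ⟨S, hS, hSa⟩ := final_aux f hd F hFc hFext (msupport K μ) (msupport_closed μ) hne hsupp
    x hx hUinv hfr
  have h0 := hatom S hSa
  rw [hS] at hnull
  have : μ Set.univ ≤ μ {S} + μ {S}ᶜ := by
    rw [← Set.union_compl_self {S}]
    exact measure_union_le _ _
  rw [h0, hnull, measure_univ] at this
  simp at this
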